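/- arXiv:2006.09572 — 2 statements merged into one kernel-verified Lean document; each statement's English description precedes it below -/
import Mathlib

section
/- Let T be a min–max term datum in n variables and let k be a positive integer. Then there exists a positive integer k' such that for every abelian ℓ-group G the following are equivalent: (a) for every g : Fin n → G there is exactly one h ∈ G with k • h = T_G(g); (b) for every x ∈ G there is exactly one h ∈ G with k' • h = x. (That is, the EFD-sentence δ_{k,t} := ∀x̄ ∃! z, kz = t(x̄) is equivalent over abelian ℓ-groups to δ_{k'} := ∀x ∃! z, k'z = x.) -/
/-- A min–max term datum in `n` variables: a finite family `u` of integer linear forms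
together with a nonempty finite family of nonempty subsets of the index set. -/
structure MinMaxTermDatum (n : ℕ) where
  p : ℕ
  u : Fin p → Fin n → ℤ
  q : ℕ
  hq : 0 < q
  S : Fin q → Finset (Fin p)
  hS : ∀ i, (S i).Nonempty

/-- The function induced by a min–max term datum on an abelian ℓ-group:
the meet over the family of the joins of the corresponding integer linear forms. -/
def MinMaxTermDatum.eval {n : ℕ} (T : MinMaxTermDatum n) {G : Type*}
    [Lattice G] [AddCommGroup G] (g : Fin n → G) : G :=
  (Finset.univ : Finset (Fin T.q)).inf' ⟨⟨0, T.hq⟩, Finset.mem_univ _⟩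
    fun i => (T.S i).sup' (T.hS i) fun j => ∑ l, (T.u j l) • g l

section LeModPolar

variable {G : Type*} [Lattice G] [AddCommGroup G]

/-- `x ≤ y` modulo the polar of `e`. -/
def LeModPolar (e x y : G) : Prop := e ⊓ (x - y)⁺ ≤ 0

namespace LeModPolar

variable {e x y : G}

theorem sub_iff : LeModPolar e x y ↔ LeModPolar e 0 (y - x) := by
  simp [LeModPolar]

theorem mono {e' : G} (hle : e' ≤ e) (h : LeModPolar e x y) : LeModPolar e' x y :=
  (inf_le_inf_right _ hle).trans h

theorem nonpos_of_le (h : LeModPolar e x 0) (hle : e ≤ x) : e ≤ 0 := by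
  refine le_trans (le_inf le_rfl ?_) h
  rw [sub_zero]
  exact hle.trans (le_posPart _)

end LeModPolar

variable [IsOrderedAddMonoid G]

theorem inf_add_le_inf_add_inf {e a b : G} (he : 0 ≤ e) (ha : 0 ≤ a) (hb : 0 ≤ b) :
    e ⊓ (a + b) ≤ e ⊓ a + e ⊓ b := by
  rw [add_inf, inf_add, inf_add]
  refine le_inf (le_inf ?_ ?_) (le_inf ?_ inf_le_right)
  · exact inf_le_left.trans (le_add_of_nonneg_left he)
  · exact inf_le_left.trans (le_add_of_nonneg_left ha)
  · exact inf_le_left.trans (le_add_of_nonneg_right hb)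

theorem inf_nsmul_nonpos {a b : G} (ha : 0 ≤ a) (hb : 0 ≤ b) (h : a ⊓ b ≤ 0) (m : ℕ) :
    a ⊓ m • b ≤ 0 := by
  induction m with
  | zero => simp
  | succ m ih =>
    rw [succ_nsmul]
    exact (inf_add_le_inf_add_inf ha (nsmul_nonneg hb m) hb).trans (add_nonpos ih h)

theorem le_nsmul_of_nonneg {a : G} (ha : 0 ≤ a) {m : ℕ} (hm : 0 < m) : a ≤ m • a := by
  simpa using nsmul_le_nsmul_left ha hm

theorem posPart_le_posPart_nsmul (x : G) {m : ℕ} (hm : 0 < m) : x⁺ ≤ (m • x)⁺ := by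
  have hp := posPart_nonneg x
  have hq := negPart_nonneg x
  have h1 := inf_nsmul_nonpos hp hq (posPart_inf_negPart_eq_zero x).le m
  rw [inf_comm] at h1
  have h2 := inf_nsmul_nonpos (nsmul_nonneg hq m) hp h1 m
  rw [inf_comm, inf_eq_sub_posPart_sub, ← nsmul_sub, posPart_sub_negPart, sub_nonpos] at h2
  exact (le_nsmul_of_nonneg hp hm).trans h2

theorem nonpos_of_nsmul_nonpos {x : G} {m : ℕ} (hm : 0 < m) (h : m • x ≤ 0) : x ≤ 0 := by
  rw [← posPart_nonpos]
  exact (posPart_le_posPart_nsmul x hm).trans (posPart_nonpos.2 h)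

theorem nsmul_left_injective_of_lattice {m : ℕ} (hm : 0 < m) {x y : G} (h : m • x = m • y) :
    x = y := by
  apply le_antisymm <;> rw [← sub_nonpos] <;> apply nonpos_of_nsmul_nonpos hm <;>
    rw [nsmul_sub, h, sub_self]

namespace LeModPolar

variable {e x y z x' y' : G}

theorem of_le (h : x ≤ y) : LeModPolar e x y := by
  unfold LeModPolar
  rw [posPart_eq_zero.2 (sub_nonpos.2 h)]
  exact inf_le_right

theorem of_posPart_le_add (he : 0 ≤ e) {w : G} (h : LeModPolar e x y) (h' : LeModPolar e x' y')
    (hw : w⁺ ≤ (x - y)⁺ + (x' - y')⁺) : e ⊓ w⁺ ≤ 0 :=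
  (inf_le_inf_left e hw).trans <|
    (inf_add_le_inf_add_inf he (posPart_nonneg _) (posPart_nonneg _)).trans (add_nonpos h h')

theorem add (he : 0 ≤ e) (h : LeModPolar e x y) (h' : LeModPolar e x' y') :
    LeModPolar e (x + x') (y + y') := by
  refine of_posPart_le_add he h h' (sup_le ?_ (add_nonneg (posPart_nonneg _) (posPart_nonneg _)))
  rw [add_sub_add_comm]
  exact add_le_add (le_posPart _) (le_posPart _)

theorem trans (he : 0 ≤ e) (h : LeModPolar e x y) (h' : LeModPolar e y z) :
    LeModPolar e x z := by
  have := h.add he h'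
  rw [sub_iff] at this ⊢
  convert this using 1
  abel

theorem sup (he : 0 ≤ e) (h : LeModPolar e x z) (h' : LeModPolar e y z) :
    LeModPolar e (x ⊔ y) z := by
  refine of_posPart_le_add he h h' (sup_le ?_ (add_nonneg (posPart_nonneg _) (posPart_nonneg _)))
  rw [sup_sub]
  exact sup_le ((le_posPart _).trans (le_add_of_nonneg_right (posPart_nonneg _)))
    ((le_posPart _).trans (le_add_of_nonneg_left (posPart_nonneg _)))

theorem inf (he : 0 ≤ e) (h : LeModPolar e z x) (h' : LeModPolar e z y) :
    LeModPolar e z (x ⊓ y) := by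
  refine of_posPart_le_add he h h' (sup_le ?_ (add_nonneg (posPart_nonneg _) (posPart_nonneg _)))
  rw [sub_inf]
  exact sup_le ((le_posPart _).trans (le_add_of_nonneg_right (posPart_nonneg _)))
    ((le_posPart _).trans (le_add_of_nonneg_left (posPart_nonneg _)))

theorem nsmul (he : 0 ≤ e) (h : LeModPolar e x y) (m : ℕ) : LeModPolar e (m • x) (m • y) := by
  induction m with
  | zero => exact of_le (by simp)
  | succ m ih => rw [succ_nsmul, succ_nsmul]; exact ih.add he h

theorem of_nsmul {m : ℕ} (hm : 0 < m) (h : LeModPolar e (m • x) (m • y)) : LeModPolar e x y := by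
  unfold LeModPolar at h ⊢
  rw [← nsmul_sub] at h
  exact (inf_le_inf_left e (posPart_le_posPart_nsmul _ hm)).trans h

theorem abs_sub (he : 0 ≤ e) (h : LeModPolar e x y) (h' : LeModPolar e y x) :
    LeModPolar e |x - y| 0 := by
  refine of_posPart_le_add he h h' (sup_le ?_ (add_nonneg (posPart_nonneg _) (posPart_nonneg _)))
  rw [sub_zero, abs, neg_sub]
  exact sup_le ((le_posPart _).trans (le_add_of_nonneg_right (posPart_nonneg _)))
    ((le_posPart _).trans (le_add_of_nonneg_left (posPart_nonneg _)))

end LeModPolar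

theorem exists_leModPolar_total (s : Finset G) {e : G} (he : 0 < e) :
    ∃ e', 0 < e' ∧ e' ≤ e ∧ ∀ x ∈ s, LeModPolar e' x 0 ∨ LeModPolar e' 0 x := by
  classical
  induction s using Finset.induction_on with
  | empty => exact ⟨e, he, le_rfl, by simp⟩
  | insert x s _ ih =>
    obtain ⟨e', he', hle, hs⟩ := ih
    by_cases hx : LeModPolar e' x 0
    · refine ⟨e', he', hle, fun y hy => ?_⟩
      rcases Finset.mem_insert.1 hy with rfl | hy
      exacts [Or.inl hx, hs y hy]
    · have hnn : 0 ≤ e' ⊓ x⁺ := le_inf he'.le (posPart_nonneg x)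
      refine ⟨e' ⊓ x⁺, lt_of_le_of_ne hnn fun h0 => hx ?_, inf_le_left.trans hle, fun y hy => ?_⟩
      · unfold LeModPolar
        rw [sub_zero, ← h0]
      · rcases Finset.mem_insert.1 hy with rfl | hy
        · right
          unfold LeModPolar
          rw [zero_sub, posPart_neg]
          exact (inf_le_inf_right _ inf_le_right).trans (posPart_inf_negPart_eq_zero y).le
        · exact (hs y hy).imp (LeModPolar.mono inf_le_left) (LeModPolar.mono inf_le_left)

/-- An element which modulo polars is always one of finitely many multiples of `d` is itself
a multiple of `d`; the quotient is the join of the elements `v j - |f - d • v j|`. -/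
theorem exists_nsmul_eq_of_locally {ι : Type*} (J : Finset ι) (v : ι → G) (f : G) {d : ℕ}
    (hd : 0 < d)
    (H : ∀ e : G, 0 < e → ∃ e', 0 < e' ∧ e' ≤ e ∧
      ∃ j ∈ J, LeModPolar e' f (d • v j) ∧ LeModPolar e' (d • v j) f) :
    ∃ h : G, d • h = f := by
  have key : ∀ h : G, (∀ e' : G, 0 < e' → ∀ j ∈ J, LeModPolar e' f (d • v j) →
      LeModPolar e' (d • v j) f → LeModPolar e' h (v j) ∧ LeModPolar e' (v j) h) →
      d • h = f := by
    intro h hh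
    by_contra hne
    have hpos : 0 < |f - d • h| :=
      lt_of_le_of_ne (abs_nonneg _) fun h0 => hne <| by
        have h1 : f - d • h ≤ 0 := h0 ▸ le_abs_self _
        have h2 : -(f - d • h) ≤ 0 := h0 ▸ neg_le_abs _
        exact (sub_eq_zero.1 (le_antisymm h1 (neg_nonpos.1 h2))).symm
    obtain ⟨e', he', hle, j, hj, h1, h2⟩ := H _ hpos
    obtain ⟨h3, h4⟩ := hh e' he' j hj h1 h2
    have := LeModPolar.abs_sub he'.le (h1.trans he'.le (h4.nsmul he'.le d))
      ((h3.nsmul he'.le d).trans he'.le h2)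
    exact he'.not_ge (this.nonpos_of_le hle)
  rcases J.eq_empty_or_nonempty with rfl | hJ
  · exact ⟨0, key 0 (by simp)⟩
  refine ⟨J.sup' hJ fun j => v j - |f - d • v j|, key _ fun e' he' j hj h1 h2 => ⟨?_, ?_⟩⟩
  · refine Finset.sup'_induction hJ _ (p := (LeModPolar e' · (v j)))
      (fun _ h _ h' => h.sup he'.le h') fun i _ => ?_
    apply LeModPolar.of_nsmul hd
    refine LeModPolar.trans he'.le (LeModPolar.of_le ?_) h1
    rw [nsmul_sub, sub_le_comm]
    calc d • v i - f ≤ |f - d • v i| := by rw [abs_sub_comm]; exact le_abs_self _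
      _ ≤ d • |f - d • v i| := le_nsmul_of_nonneg (abs_nonneg _) hd
  · have h3 := LeModPolar.abs_sub he'.le h1 h2
    have h4 : LeModPolar e' (v j) (v j - |f - d • v j|) := by
      rw [LeModPolar.sub_iff] at h3 ⊢
      convert h3 using 1
      abel
    exact h4.trans he'.le (LeModPolar.of_le (Finset.le_sup' (fun j => v j - |f - d • v j|) hj))

end LeModPolar

/-- Gordan's alternative over `ℤ`, by Fourier–Motzkin elimination: finitely many vectors in an
additive semigroup avoiding `0` lie strictly on one side of an integral hyperplane. -/
theorem exists_addMonoidHom_pos {ι : Type*} (Q : AddSubsemigroup (ι → ℤ)) (hQ : 0 ∉ Q)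
    (s : Finset ι) (W : Finset (ι → ℤ)) (hW : ∀ w ∈ W, w ∈ Q ∧ ∀ l ∉ s, w l = 0) :
    ∃ φ : (ι → ℤ) →+ ℤ, ∀ w ∈ W, 0 < φ w := by
  classical
  induction s using Finset.induction_on generalizing W with
  | empty =>
    refine ⟨0, fun w hw => absurd (hW w hw).1 ?_⟩
    rwa [show w = 0 from funext fun l => (hW w hw).2 l (by simp)]
  | insert i s hi ih =>
    have hsmul : ∀ (m : ℤ) (w : ι → ℤ), 0 < m → w ∈ Q → m • w ∈ Q := by
      intro m w hm hw
      lift m to ℕ using hm.le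
      rw [natCast_zsmul]
      clear hW
      induction m with
      | zero => omega
      | succ m ih =>
        rcases Nat.eq_zero_or_pos m with rfl | hm'
        · simpa using hw
        · rw [succ_nsmul]
          exact Q.add_mem (ih (by omega)) hw
    let P := W.filter fun w => 0 < w i
    let N := W.filter fun w => w i < 0
    let W' := W.filter (fun w => w i = 0) ∪
      (P ×ˢ N).image fun xy => (-xy.2 i) • xy.1 + xy.1 i • xy.2
    obtain ⟨φ, hφ⟩ := ih W' (by
      intro w hw
      rcases Finset.mem_union.1 hw with hw | hw
      · obtain ⟨hw, hwi⟩ := Finset.mem_filter.1 hw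
        refine ⟨(hW w hw).1, fun l hl => ?_⟩
        by_cases hli : l = i
        · exact hli ▸ hwi
        · exact (hW w hw).2 l (by simp [hl, hli])
      · obtain ⟨⟨x, y⟩, hxy, rfl⟩ := Finset.mem_image.1 hw
        obtain ⟨hx, hy⟩ := Finset.mem_product.1 hxy
        obtain ⟨hx, hxi⟩ := Finset.mem_filter.1 hx
        obtain ⟨hy, hyi⟩ := Finset.mem_filter.1 hy
        dsimp only at hx hxi hy hyi ⊢
        refine ⟨Q.add_mem (hsmul _ _ (by omega) (hW x hx).1) (hsmul _ _ hxi (hW y hy).1),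
          fun l hl => ?_⟩
        simp only [Pi.add_apply, Pi.smul_apply, smul_eq_mul]
        by_cases hli : l = i
        · rw [hli]; ring
        · rw [(hW x hx).2 l (by simp [hl, hli]), (hW y hy).2 l (by simp [hl, hli])]; ring)
    obtain ⟨t, ht1, ht2⟩ := Finset.exists_between'
      (P.image fun w => -(φ w : ℚ) / w i) (N.image fun w => (φ w : ℚ) / -w i) (by
        intro a ha b hb
        obtain ⟨x, hx, rfl⟩ := Finset.mem_image.1 ha
        obtain ⟨y, hy, rfl⟩ := Finset.mem_image.1 hb
        have h := hφ _ (Finset.mem_union_right _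
          (Finset.mem_image_of_mem _ (Finset.mk_mem_product hx hy)))
        have hxi : (0 : ℚ) < x i := by exact_mod_cast (Finset.mem_filter.1 hx).2
        have hyi : (y i : ℚ) < 0 := by exact_mod_cast (Finset.mem_filter.1 hy).2
        simp only [map_add, map_zsmul, smul_eq_mul] at h
        have h' : (0 : ℚ) < -y i * φ x + x i * φ y := by exact_mod_cast h
        rw [div_lt_div_iff₀ hxi (by linarith)]
        linarith)
    refine ⟨t.den • φ + t.num • (Pi.evalAddMonoidHom (fun _ : ι => ℤ) i), fun w hw => ?_⟩
    have hden : (0 : ℚ) < t.den := by exact_mod_cast t.den_pos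
    have hpos : (0 : ℚ) < φ w + t * w i := by
      rcases lt_trichotomy (w i) 0 with h | h | h
      · have := ht2 _ (Finset.mem_image_of_mem _ (Finset.mem_filter.2 ⟨hw, h⟩))
        have h' : (w i : ℚ) < 0 := by exact_mod_cast h
        rw [lt_div_iff₀ (by linarith)] at this
        linarith
      · have := hφ w (Finset.mem_union_left _ (Finset.mem_filter.2 ⟨hw, h⟩))
        rw [h]
        simpa using this
      · have := ht1 _ (Finset.mem_image_of_mem _ (Finset.mem_filter.2 ⟨hw, h⟩))
        have h' : (0 : ℚ) < w i := by exact_mod_cast h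
        rw [div_lt_iff₀ h'] at this
        linarith
    have := mul_pos hden hpos
    have e : (t.den : ℚ) * (φ w + t * w i) = t.den * φ w + t.num * w i := by
      rw [mul_add, ← mul_assoc, Rat.den_mul_eq_num]
    rw [e] at this
    simp only [AddMonoidHom.add_apply, AddMonoidHom.smul_apply, Pi.evalAddMonoidHom_apply,
      nsmul_eq_mul, smul_eq_mul]
    exact_mod_cast this

/-- The integral linear form with coefficients `w`, evaluated at `g`. -/
def intForm {n : ℕ} {G : Type*} [AddCommGroup G] (g : Fin n → G) : (Fin n → ℤ) →+ G where
  toFun w := ∑ l, w l • g l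
  map_zero' := by simp
  map_add' v w := by simp [add_smul, Finset.sum_add_distrib]

theorem intForm_apply {n : ℕ} {G : Type*} [AddCommGroup G] (g : Fin n → G) (w : Fin n → ℤ) :
    intForm g w = ∑ l, w l • g l := rfl

namespace MinMaxTermDatum

variable {n : ℕ} (T : MinMaxTermDatum n)

/-- `c j` is the value of the min–max expression at the values `c`. -/
def Selects {α : Type*} [LE α] (c : Fin T.p → α) (j : Fin T.p) : Prop :=
  (∃ i, ∀ m ∈ T.S i, c m ≤ c j) ∧ ∀ i, ∃ m ∈ T.S i, c j ≤ c m

theorem exists_selects {α : Type*} [LinearOrder α] (c : Fin T.p → α) :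
    ∃ j, T.Selects c j := by
  obtain ⟨i, -, hi⟩ := Finset.exists_mem_eq_inf' (s := (Finset.univ : Finset (Fin T.q)))
    ⟨⟨0, T.hq⟩, Finset.mem_univ _⟩ fun i => (T.S i).sup' (T.hS i) c
  obtain ⟨j, -, hj⟩ := Finset.exists_mem_eq_sup' (T.hS i) c
  refine ⟨j, ⟨i, fun m hm => hj ▸ Finset.le_sup' c hm⟩, fun i' => ?_⟩
  obtain ⟨m, hm, hmc⟩ := Finset.exists_mem_eq_sup' (T.hS i') c
  refine ⟨m, hm, ?_⟩
  rw [← hmc, ← hj, ← hi]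
  exact Finset.inf'_le _ (Finset.mem_univ i')

variable {T}

section

variable {G : Type*} [Lattice G] [AddCommGroup G]

theorem Selects.eval_eq {g : Fin n → G} {j : Fin T.p}
    (h : T.Selects (fun j => intForm g (T.u j)) j) : T.eval g = intForm g (T.u j) := by
  obtain ⟨⟨i, hi⟩, h⟩ := h
  apply le_antisymm
  · exact (Finset.inf'_le _ (Finset.mem_univ i)).trans (Finset.sup'_le _ _ hi)
  · refine Finset.le_inf' _ _ fun i _ => ?_
    obtain ⟨m, hm, hle⟩ := h i
    exact hle.trans (Finset.le_sup' (fun j => ∑ l, T.u j l • g l) hm)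

theorem Selects.of_monotone {α β : Type*} [LE α] [LE β] {c : Fin T.p → α} {c' : Fin T.p → β}
    {j : Fin T.p} (h : T.Selects c j) (hc : ∀ i j, c i ≤ c j → c' i ≤ c' j) :
    T.Selects c' j :=
  ⟨h.1.imp fun _ hi m hm => hc _ _ (hi m hm), fun i => (h.2 i).imp fun _ hm => ⟨hm.1, hc _ _ hm.2⟩⟩

variable [IsOrderedAddMonoid G]

theorem Selects.eval_leModPolar {α : Type*} [LE α] {c : Fin T.p → α} {j : Fin T.p}
    (h : T.Selects c j) {g : Fin n → G} {e : G} (he : 0 ≤ e)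
    (hc : ∀ i j, c i ≤ c j → LeModPolar e (intForm g (T.u i)) (intForm g (T.u j))) :
    LeModPolar e (T.eval g) (intForm g (T.u j)) ∧
      LeModPolar e (intForm g (T.u j)) (T.eval g) := by
  obtain ⟨⟨i, hi⟩, h⟩ := h
  constructor
  · refine LeModPolar.trans he (LeModPolar.of_le (Finset.inf'_le _ (Finset.mem_univ i))) ?_
    exact Finset.sup'_induction _ _ (p := (LeModPolar e · (intForm g (T.u j))))
      (fun _ h _ h' => h.sup he h') fun m hm => hc _ _ (hi m hm)
  · refine Finset.inf'_induction _ _ (fun _ h _ h' => h.inf he h') fun i _ => ?_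
    obtain ⟨m, hm, hle⟩ := h i
    exact (hc _ _ hle).trans he
      (LeModPolar.of_le (Finset.le_sup' (fun j => ∑ l, T.u j l • g l) hm))

/-- A nonnegative element satisfies `T (a₁ x, …, aₙ x) = T a • x`. -/
theorem eval_zsmul (a : Fin n → ℤ) {x : G} (hx : 0 ≤ x) :
    T.eval (fun l => a l • x) = T.eval a • x := by
  have hform : ∀ w : Fin n → ℤ, intForm (fun l => a l • x) w = intForm a w • x := fun w => by
    simp [intForm_apply, Finset.sum_smul, mul_smul]
  obtain ⟨j, hj⟩ := T.exists_selects fun j => intForm a (T.u j)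
  rw [hj.eval_eq, ← hform]
  apply Selects.eval_eq
  refine hj.of_monotone fun i j hij => ?_
  rw [hform, hform]
  exact zsmul_le_zsmul_left hx hij

end

/-- If an integer point orders all the distinct linear forms of `T` strictly, then the form
selected at this point is essential: its coefficients inherit every divisor common to the
values of `T` on integer points. -/
theorem Selects.dvd {d : ℤ} (hd : ∀ a : Fin n → ℤ, d ∣ T.eval a) {a : Fin n → ℤ}
    (ha : ∀ i j, T.u i ≠ T.u j → intForm a (T.u i) ≠ intForm a (T.u j)) {j : Fin T.p}
    (h : T.Selects (fun j => intForm a (T.u j)) j) (l : Fin n) : d ∣ T.u j l := by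
  classical
  let M : ℤ := 1 + ∑ i, |T.u i l| + ∑ i, |T.u i l|
  have hM : ∀ i m, T.u m l - T.u i l < M := by
    intro i m
    have h1 := Finset.single_le_sum (f := fun i => |T.u i l|) (fun _ _ => abs_nonneg _)
      (Finset.mem_univ i)
    have h2 := Finset.single_le_sum (f := fun i => |T.u i l|) (fun _ _ => abs_nonneg _)
      (Finset.mem_univ m)
    have h3 := neg_abs_le (T.u i l)
    have h4 := le_abs_self (T.u m l)
    simp only [M]
    linarith
  have hM0 : 0 < M := by simpa using hM j j
  have hform : ∀ (ε : ℤ) (w : Fin n → ℤ),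
      intForm (M • a + ε • Pi.single l 1) w = M * intForm a w + ε * w l := by
    intro ε w
    simp [intForm_apply, mul_add, Finset.sum_add_distrib, Finset.mul_sum, Pi.single_apply,
      mul_left_comm M, mul_comm ε]
  have hval : ∀ ε : ℤ, (ε = 0 ∨ ε = 1) →
      T.eval (M • a + ε • Pi.single l (1 : ℤ)) = M * intForm a (T.u j) + ε * T.u j l := by
    intro ε hε
    rw [← hform]
    apply Selects.eval_eq
    refine h.of_monotone fun i m him => ?_
    rw [hform, hform]
    by_cases hu : T.u i = T.u m
    · rw [hu]
    · have hlt := lt_of_le_of_ne him (ha i m hu)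
      have h1 := hM m i
      have h2 : M * (intForm a (T.u i) + 1) ≤ M * intForm a (T.u m) :=
        mul_le_mul_of_nonneg_left hlt hM0.le
      rcases hε with rfl | rfl <;> linarith
  have h0 := hval 0 (Or.inl rfl)
  have h1 := hval 1 (Or.inr rfl)
  have := dvd_sub (hd _) (hd _) (a := d) (b := T.eval (M • a + (1 : ℤ) • Pi.single l (1 : ℤ)))
    (c := T.eval (M • a + (0 : ℤ) • Pi.single l (1 : ℤ)))
  rw [h0, h1] at this
  simpa using this

section

variable {G : Type*} [Lattice G] [AddCommGroup G] [IsOrderedAddMonoid G]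

/-- Integer points realise, up to refinement, the order pattern of finitely many linear forms at
a point of an abelian ℓ-group modulo the polar of an element. -/
theorem exists_int_point {κ : Type*} [Finite κ] (u : κ → Fin n → ℤ) (g : Fin n → G) {e : G}
    (he : 0 ≤ e) (htot : ∀ i j, LeModPolar e (intForm g (u i - u j)) 0 ∨
      LeModPolar e 0 (intForm g (u i - u j))) :
    ∃ a : Fin n → ℤ, (∀ i j, u i ≠ u j → intForm a (u i) ≠ intForm a (u j)) ∧
      ∀ i j, intForm a (u i) ≤ intForm a (u j) →
        LeModPolar e (intForm g (u i)) (intForm g (u j)) := by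
  classical
  have := Fintype.ofFinite κ
  have hneg : ∀ w, LeModPolar e 0 (intForm g (-w)) ↔ LeModPolar e (intForm g w) 0 := fun w => by
    rw [LeModPolar.sub_iff (x := intForm g w), map_neg, zero_sub]
  let Q : AddSubsemigroup (Fin n → ℤ) :=
    { carrier := {w | LeModPolar e 0 (intForm g w) ∧
        (LeModPolar e (intForm g w) 0 → 0 < toLex w)}
      add_mem' := by
        rintro v w ⟨hv, hv'⟩ ⟨hw, hw'⟩
        have hvw : LeModPolar e (intForm g v) (intForm g (v + w)) := by
          rw [LeModPolar.sub_iff]; simpa using hw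
        have hwv : LeModPolar e (intForm g w) (intForm g (v + w)) := by
          rw [LeModPolar.sub_iff]; simpa using hv
        exact ⟨hv.trans he hvw, fun h =>
          add_pos (hv' (hvw.trans he h)) (hw' (hwv.trans he h))⟩ }
  have hmemQ : ∀ w, w ∈ Q ↔ LeModPolar e 0 (intForm g w) ∧
      (LeModPolar e (intForm g w) 0 → 0 < toLex w) := fun _ => Iff.rfl
  have hQ0 : (0 : Fin n → ℤ) ∉ Q := fun h =>
    lt_irrefl (0 : Lex (Fin n → ℤ)) (((hmemQ 0).1 h).2 (LeModPolar.of_le (by simp)))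
  have hQ : ∀ i j, u i ≠ u j → u i - u j ∈ Q ∨ u j - u i ∈ Q := by
    intro i j hij
    rw [← neg_sub (u i) (u j), hmemQ, hmemQ, hneg, ← hneg (-_), neg_neg]
    have hlex : 0 < toLex (u i - u j) ∨ 0 < toLex (-(u i - u j)) := by
      rcases lt_trichotomy (toLex (u i - u j)) 0 with h | h | h
      · right
        rw [toLex_neg]
        exact neg_pos.2 h
      · exact absurd (sub_eq_zero.1 (toLex.injective h)) hij
      · exact Or.inl h
    have := htot i j
    tauto
  obtain ⟨φ, hφ⟩ := exists_addMonoidHom_pos Q hQ0 Finset.univ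
    ((Finset.univ.image fun ij : κ × κ => u ij.1 - u ij.2).filter (· ∈ Q))
    (fun w hw => ⟨(Finset.mem_filter.1 hw).2, fun l hl => absurd (Finset.mem_univ l) hl⟩)
  have hpos : ∀ i j, u i - u j ∈ Q → φ (u j) < φ (u i) := fun i j h => by
    rw [← sub_pos, ← map_sub]
    exact hφ _ (Finset.mem_filter.2 ⟨Finset.mem_image_of_mem (fun ij : κ × κ => u ij.1 - u ij.2)
      (Finset.mem_univ (i, j)), h⟩)
  have hform : ∀ w, intForm (fun l => φ (Pi.single l 1)) w = φ w := fun w => by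
    conv_rhs => rw [← Finset.univ_sum_single w]
    rw [map_sum, intForm_apply]
    refine Finset.sum_congr rfl fun l _ => ?_
    rw [← map_zsmul, ← Pi.single_smul, smul_eq_mul, mul_one]
  refine ⟨fun l => φ (Pi.single l 1), fun i j hij => ?_, fun i j hij => ?_⟩
  · rw [hform, hform]
    exact (hQ i j hij).elim (fun h => (hpos _ _ h).ne') fun h => (hpos _ _ h).ne
  · rw [hform, hform] at hij
    by_cases hu : u i = u j
    · rw [hu]; exact LeModPolar.of_le le_rfl
    · rcases hQ i j hu with h | h
      · exact absurd (hpos _ _ h) hij.not_gt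
      · rw [LeModPolar.sub_iff, ← map_sub]
        exact ((hmemQ _).1 h).1

/-- A divisor common to all values of `T` on integer points divides the values of `T` on every
abelian ℓ-group. -/
theorem exists_nsmul_eq_eval {d : ℕ} (hd0 : 0 < d) (hd : ∀ a : Fin n → ℤ, (d : ℤ) ∣ T.eval a)
    (g : Fin n → G) : ∃ h : G, d • h = T.eval g := by
  classical
  have hdiv : ∀ j : Fin T.p, ∃ v : Fin n → ℤ, (∀ l, (d : ℤ) ∣ T.u j l) → d • v = T.u j := by
    intro j
    refine ⟨fun l => T.u j l / d, fun h => funext fun l => ?_⟩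
    simpa using Int.mul_ediv_cancel' (h l)
  choose v hv using hdiv
  refine exists_nsmul_eq_of_locally (Finset.univ : Finset (Fin T.p)) (fun j => intForm g (v j)) _
    hd0 fun e he => ?_
  obtain ⟨e', he', hle, htot⟩ := exists_leModPolar_total
    (Finset.univ.image fun ij : Fin T.p × Fin T.p => intForm g (T.u ij.1 - T.u ij.2)) he
  obtain ⟨a, ha, hag⟩ := exists_int_point T.u g he'.le fun i j =>
    htot _ (Finset.mem_image_of_mem
      (fun ij : Fin T.p × Fin T.p => intForm g (T.u ij.1 - T.u ij.2)) (Finset.mem_univ (i, j)))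
  obtain ⟨j, hj⟩ := T.exists_selects fun j => intForm a (T.u j)
  refine ⟨e', he', hle, j, Finset.mem_univ j, ?_⟩
  rw [← map_nsmul, hv j (hj.dvd hd ha)]
  exact hj.eval_leModPolar he'.le hag

end

end MinMaxTermDatum

/-- For every ℓ-group term `t` (presented as a min–max of integer linear forms) and every
positive integer `k` there is a positive integer `k'` such that the EFD-sentence
`δ_{k,t} : ∀ x̄ ∃! z, k z = t(x̄)` is equivalent to `δ_{k'} : ∀ x ∃! z, k' z = x`
over all abelian ℓ-groups. -/
theorem efd_kt_equiv_delta {n : ℕ} (T : MinMaxTermDatum n) (k : ℕ) (hk : 0 < k) :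
    ∃ k' : ℕ, 0 < k' ∧
      ∀ (G : Type) [Lattice G] [AddCommGroup G] [CovariantClass G G (· + ·) (· ≤ ·)],
        (∀ g : Fin n → G, ∃! h : G, k • h = T.eval g) ↔
        (∀ x : G, ∃! h : G, k' • h = x) := by
  let A : Set ℤ := insert (k : ℤ) (Set.range fun a : Fin n → ℤ => T.eval a)
  obtain ⟨c, hc⟩ := Int.subgroup_cyclic (AddSubgroup.closure A)
  have hdvd : ∀ m ∈ A, (c.natAbs : ℤ) ∣ m := by
    intro m hm
    have h := AddSubgroup.subset_closure hm
    rw [hc] at h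
    obtain ⟨r, rfl⟩ := AddSubgroup.mem_closure_singleton.1 h
    exact Int.natAbs_dvd.2 (Dvd.intro_left r rfl)
  have hmem : (c.natAbs : ℤ) ∈ AddSubgroup.closure A := by
    have h : c ∈ AddSubgroup.closure A := hc ▸ AddSubgroup.subset_closure rfl
    rcases Int.natAbs_eq c with h' | h'
    · rwa [← h']
    · rw [h'] at h
      simpa using h
  generalize c.natAbs = d at hdvd hmem
  obtain ⟨k', rfl⟩ : d ∣ k := Int.natCast_dvd_natCast.1 (hdvd k (Set.mem_insert _ _))
  have hd0 : 0 < d := Nat.pos_of_mul_pos_right hk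
  have hk' : 0 < k' := Nat.pos_of_mul_pos_left hk
  refine ⟨k', hk', fun G _ _ _ => ?_⟩
  have : IsOrderedAddMonoid G :=
    ⟨fun a b h c => by simpa only [add_comm _ c] using add_le_add_right h c, fun a b h c => by
      simpa only [add_comm _ c] using add_le_add_right h c⟩
  constructor
  · intro H
    have hnn : ∀ x : G, 0 ≤ x → ∃ h : G, k' • h = x := by
      intro x hx
      have hle : AddSubgroup.closure A ≤
          (nsmulAddMonoidHom (α := G) (d * k')).range.comap ((zmultiplesHom G) x) := by
        rw [AddSubgroup.closure_le]
        rintro m (rfl | ⟨a, rfl⟩)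
        · exact ⟨x, by simpa using (natCast_zsmul x (d * k')).symm⟩
        · obtain ⟨h, hh, -⟩ := H fun l => a l • x
          exact ⟨h, by simpa [MinMaxTermDatum.eval_zsmul a hx] using hh⟩
      obtain ⟨h, hh⟩ := hle hmem
      refine ⟨h, nsmul_left_injective_of_lattice hd0 ?_⟩
      rw [← mul_nsmul']
      simpa using hh
    intro x
    obtain ⟨y, hy⟩ := hnn _ (posPart_nonneg x)
    obtain ⟨z, hz⟩ := hnn _ (negPart_nonneg x)
    have hx : k' • (y - z) = x := by rw [nsmul_sub, hy, hz, posPart_sub_negPart]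
    exact ⟨y - z, hx, fun w hw => nsmul_left_injective_of_lattice hk' (hw.trans hx.symm)⟩
  · intro H g
    obtain ⟨y, hy⟩ := T.exists_nsmul_eq_eval hd0
      (fun a => hdvd _ (Set.mem_insert_of_mem _ ⟨a, rfl⟩)) g
    obtain ⟨h, hh, -⟩ := H y
    have hx : (d * k') • h = T.eval g := by rw [mul_nsmul', hh, hy]
    exact ⟨h, hx, fun w hw => nsmul_left_injective_of_lattice hk (hw.trans hx.symm)⟩
end

section
/- Let φ be an EFD-system in the language 𝓛 of ℓ-groups (with n input variables and m output variables) that is satisfied by some nontrivial abelian ℓ-group. Then there exist positive integers k_1, …, k_m and 𝓛-terms t_1, …, t_m with variables indexed by Fin n such that for every abelian ℓ-group G: G satisfies φ if and only if for every j and every x : Fin n → G there is exactly one z ∈ G with k_j • z = Term.realize x (t_j). -/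
open FirstOrder Language

/-- The binary function symbols of the language of ℓ-groups: `+`, `∨`, `∧`. -/
inductive LGrpBin : Type
  | add : LGrpBin
  | join : LGrpBin
  | meet : LGrpBin

/-- Function symbols of the language of ℓ-groups: a constant `0`, a unary `-`,
and binary `+`, `∨`, `∧`. -/
def LGrpFunc : ℕ → Type
  | 0 => Unit
  | 1 => Unit
  | 2 => LGrpBin
  | _ => Empty

/-- The first-order language of (abelian) ℓ-groups. -/
def LGrpLang : FirstOrder.Language :=
  ⟨LGrpFunc, fun _ => Empty⟩

/-- The evident `LGrpLang`-structure on any abelian ℓ-group. -/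
instance lgrpStructure (G : Type*) [Lattice G] [AddCommGroup G] :
    LGrpLang.Structure G where
  funMap {n} f x :=
    match n, f, x with
    | 0, _, _ => 0
    | 1, _, x => -(x 0)
    | 2, LGrpBin.add, x => x 0 + x 1
    | 2, LGrpBin.join, x => x 0 ⊔ x 1
    | 2, LGrpBin.meet, x => x 0 ⊓ x 1
    | (_+3), f, _ => f.elim
  RelMap {_} r := r.elim

/-- An EFD-system in a language `L`: data for an EFD-sentence
`∀ x_1 … x_n ∃! z_1 … z_m, ⋀_{i<r} s_i(x̄,z̄) = t_i(x̄,z̄)` with `m, r ≥ 1`. -/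
structure EFDSystem (L : FirstOrder.Language) where
  n : ℕ
  m : ℕ
  r : ℕ
  hm : 0 < m
  hr : 0 < r
  lhs : Fin r → L.Term (Fin n ⊕ Fin m)
  rhs : Fin r → L.Term (Fin n ⊕ Fin m)

/-- A structure `G` satisfies an EFD-system if for every tuple `x` there is exactly one
tuple `z` solving all the equations. -/
def EFDSystem.Satisfies {L : FirstOrder.Language} (φ : EFDSystem L)
    (G : Type*) [L.Structure G] : Prop :=
  ∀ x : Fin φ.n → G, ∃! z : Fin φ.m → G, ∀ i : Fin φ.r,
    Term.realize (Sum.elim x z) (φ.lhs i) = Term.realize (Sum.elim x z) (φ.rhs i)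

namespace LGrp

section Terms

variable {α : Type*}

def zeroTerm : LGrpLang.Term α := Term.func (L := LGrpLang) (l := 0) () ![]

def negTerm (s : LGrpLang.Term α) : LGrpLang.Term α := Term.func (L := LGrpLang) (l := 1) () ![s]

def binTerm (f : LGrpBin) (s t : LGrpLang.Term α) : LGrpLang.Term α :=
  Term.func (L := LGrpLang) (l := 2) f ![s, t]

theorem term_induction {p : LGrpLang.Term α → Prop} (var : ∀ a, p (Term.var a))
    (zero : p zeroTerm) (neg : ∀ s, p s → p (negTerm s))
    (bin : ∀ f s t, p s → p t → p (binTerm f s t)) (t : LGrpLang.Term α) : p t := by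
  induction t with
  | var a => exact var a
  | @func l f ts ih =>
    match l, f, ts, ih with
    | 0, (), ts, _ =>
      rw [show ts = ![] from Subsingleton.elim _ _]
      exact zero
    | 1, (), ts, ih =>
      rw [show ts = ![ts 0] by ext i; fin_cases i; rfl]
      exact neg _ (ih 0)
    | 2, f, ts, ih =>
      rw [show ts = ![ts 0, ts 1] by ext i; fin_cases i <;> rfl]
      exact bin f _ _ (ih 0) (ih 1)
    | _ + 3, f, _, _ => exact f.elim

variable {G : Type*} [Lattice G] [AddCommGroup G] (v : α → G) (s t : LGrpLang.Term α)

@[simp]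
theorem realize_zeroTerm : (zeroTerm : LGrpLang.Term α).realize v = 0 := rfl

@[simp]
theorem realize_negTerm : (negTerm s).realize v = -s.realize v := rfl

@[simp]
theorem realize_addTerm : (binTerm .add s t).realize v = s.realize v + t.realize v := rfl

@[simp]
theorem realize_joinTerm : (binTerm .join s t).realize v = s.realize v ⊔ t.realize v := rfl

@[simp]
theorem realize_meetTerm : (binTerm .meet s t).realize v = s.realize v ⊓ t.realize v := rfl

theorem exists_realize_eq_nsmul (k : ℕ) (t : LGrpLang.Term α) :
    ∃ s : LGrpLang.Term α, ∀ (G : Type) [Lattice G] [AddCommGroup G] (v : α → G),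
      s.realize v = k • t.realize v := by
  induction k with
  | zero => exact ⟨zeroTerm, fun G _ _ v => by simp⟩
  | succ k ih =>
    obtain ⟨s, hs⟩ := ih
    exact ⟨binTerm .add s t, fun G _ _ v => by simp [hs, succ_nsmul]⟩

/-- Group homomorphisms preserving joins also preserve meets, hence all terms. -/
theorem realize_comp_of_map_sup {H : Type*} [AddLeftMono G] [Lattice H] [AddCommGroup H]
    [AddLeftMono H] (f : G →+ H) (hf : ∀ a b, f (a ⊔ b) = f a ⊔ f b) :
    t.realize (f ∘ v) = f (t.realize v) := by
  have inf : ∀ a b, f (a ⊓ b) = f a ⊓ f b := fun a b => by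
    rw [← neg_neg (a ⊓ b), neg_inf, map_neg, hf, neg_sup, map_neg, map_neg, neg_neg, neg_neg]
  induction t using term_induction with
  | var a => rfl
  | zero => simp
  | neg s hs => simp [hs]
  | bin g s t hs ht => cases g <;> simp [hs, ht, hf, inf]

end Terms

section Forms

variable {α : Type*} [Fintype α] {D : Type*} [AddCommGroup D] [Module ℚ D]

/-- The value at `d` of a rational linear form, given by its coefficients. -/
abbrev evalForm (d : α → D) : (α → ℚ) →ₗ[ℚ] D := Fintype.linearCombination ℚ d

/-- Two tuples on which the forms in `Λ` have the same nonnegativity pattern. -/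
def SameSign {E : Type*} [AddCommGroup E] [Module ℚ E] [LE D] [LE E]
    (Λ : Set (α → ℚ)) (d : α → D) (e : α → E) : Prop :=
  ∀ l ∈ Λ, 0 ≤ evalForm d l ↔ 0 ≤ evalForm e l

theorem evalForm_single [DecidableEq α] (d : α → D) (a : α) :
    evalForm d (Pi.single a 1) = d a := by
  simp [Fintype.linearCombination_apply_single]

theorem evalForm_succ {n : ℕ} (d : Fin (n + 1) → D) (l : Fin (n + 1) → ℚ) :
    evalForm d l = l 0 • d 0 + evalForm (Fin.tail d) (Fin.tail l) := by
  simp [Fintype.linearCombination_apply, Fin.sum_univ_succ, Fin.tail]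

theorem exists_pieces (s : LGrpLang.Term α) :
    ∃ Λ L : Set (α → ℚ), Λ.Finite ∧ L.Finite ∧
      ∀ (D E : Type) [AddCommGroup D] [LinearOrder D] [IsOrderedAddMonoid D] [Module ℚ D]
        [AddCommGroup E] [LinearOrder E] [IsOrderedAddMonoid E] [Module ℚ E]
        (d : α → D) (e : α → E), SameSign Λ d e →
          ∃ l ∈ L, s.realize d = evalForm d l ∧ s.realize e = evalForm e l := by
  classical
  induction s using term_induction with
  | var a =>
    refine ⟨∅, {Pi.single a 1}, Set.finite_empty, Set.finite_singleton _, ?_⟩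
    intros
    exact ⟨_, rfl, (evalForm_single _ a).symm, (evalForm_single _ a).symm⟩
  | zero =>
    refine ⟨∅, {0}, Set.finite_empty, Set.finite_singleton _, ?_⟩
    intros
    exact ⟨_, rfl, by simp⟩
  | neg s ih =>
    obtain ⟨Λ, L, hΛ, hL, h⟩ := ih
    refine ⟨Λ, (- ·) '' L, hΛ, hL.image _, ?_⟩
    intro D E _ _ _ _ _ _ _ _ d e hde
    obtain ⟨l, hl, h₁, h₂⟩ := h D E d e hde
    exact ⟨-l, ⟨l, hl, rfl⟩, by rw [map_neg, realize_negTerm, h₁],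
      by rw [map_neg, realize_negTerm, h₂]⟩
  | bin f s t hs ht =>
    obtain ⟨Λ, L, hΛ, hL, h⟩ := hs
    obtain ⟨Λ', L', hΛ', hL', h'⟩ := ht
    refine ⟨Λ ∪ Λ' ∪ Set.image2 (· - ·) L L', L ∪ L' ∪ Set.image2 (· + ·) L L',
      (hΛ.union hΛ').union (hL.image2 _ hL'), (hL.union hL').union (hL.image2 _ hL'), ?_⟩
    intro D E _ _ _ _ _ _ _ _ d e hde
    obtain ⟨l, hl, h₁, h₂⟩ := h D E d e fun x hx => hde x (.inl (.inl hx))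
    obtain ⟨l', hl', h₁', h₂'⟩ := h' D E d e fun x hx => hde x (.inl (.inr hx))
    have hll := hde _ (.inr ⟨l, hl, l', hl', rfl⟩)
    simp only [map_sub, sub_nonneg] at hll
    cases f with
    | add =>
      exact ⟨_, .inr ⟨l, hl, l', hl', rfl⟩, by rw [map_add, realize_addTerm, h₁, h₁'],
        by rw [map_add, realize_addTerm, h₂, h₂']⟩
    | join =>
      rw [realize_joinTerm, realize_joinTerm, h₁, h₁', h₂, h₂']
      by_cases hc : evalForm d l' ≤ evalForm d l
      · exact ⟨l, .inl (.inl hl), sup_eq_left.2 hc, sup_eq_left.2 (hll.1 hc)⟩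
      · exact ⟨l', .inl (.inr hl'), sup_eq_right.2 (le_of_not_ge hc),
          sup_eq_right.2 (le_of_not_ge (mt hll.2 hc))⟩
    | meet =>
      rw [realize_meetTerm, realize_meetTerm, h₁, h₁', h₂, h₂']
      by_cases hc : evalForm d l' ≤ evalForm d l
      · exact ⟨l', .inl (.inr hl'), inf_eq_right.2 hc, inf_eq_right.2 (hll.1 hc)⟩
      · exact ⟨l, .inl (.inl hl), inf_eq_left.2 (le_of_not_ge hc),
          inf_eq_left.2 (le_of_not_ge (mt hll.2 hc))⟩

theorem exists_forms_deciding {ι : Type*} [Finite ι] (s t : ι → LGrpLang.Term α) :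
    ∃ Λ : Set (α → ℚ), Λ.Finite ∧
      ∀ (D E : Type) [AddCommGroup D] [LinearOrder D] [IsOrderedAddMonoid D] [Module ℚ D]
        [AddCommGroup E] [LinearOrder E] [IsOrderedAddMonoid E] [Module ℚ E]
        (d : α → D) (e : α → E), SameSign Λ d e →
          ∀ i, (s i).realize d = (t i).realize d ↔ (s i).realize e = (t i).realize e := by
  choose Λ L hΛ hL h using fun i => exists_pieces (s i)
  choose Λ' L' hΛ' hL' h' using fun i => exists_pieces (t i)
  refine ⟨⋃ i, (Λ i ∪ Λ' i ∪ Set.image2 (· - ·) (L i) (L' i) ∪ Set.image2 (· - ·) (L' i) (L i)),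
    Set.finite_iUnion fun i => (((hΛ i).union (hΛ' i)).union ((hL i).image2 _ (hL' i))).union
      ((hL' i).image2 _ (hL i)), ?_⟩
  intro D E _ _ _ _ _ _ _ _ d e hde i
  obtain ⟨l, hl, h₁, h₂⟩ := h i D E d e fun x hx =>
    hde x (Set.mem_iUnion.2 ⟨i, .inl (.inl (.inl hx))⟩)
  obtain ⟨l', hl', h₁', h₂'⟩ := h' i D E d e fun x hx =>
    hde x (Set.mem_iUnion.2 ⟨i, .inl (.inl (.inr hx))⟩)
  have hll := hde _ (Set.mem_iUnion.2 ⟨i, .inl (.inr ⟨l, hl, l', hl', rfl⟩)⟩)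
  have hll' := hde _ (Set.mem_iUnion.2 ⟨i, .inr ⟨l', hl', l, hl, rfl⟩⟩)
  simp only [map_sub, sub_nonneg] at hll hll'
  rw [h₁, h₂, h₁', h₂', le_antisymm_iff, le_antisymm_iff, hll, hll']

end Forms

section Transfer

theorem exists_rat_same_cut {ι D : Type*} [Finite ι] [LinearOrder D] (a : ι → D) (b : ι → ℚ)
    (hab : ∀ i j, a i ≤ a j ↔ b i ≤ b j) (c : D) :
    ∃ q : ℚ, ∀ i, (a i ≤ c ↔ b i ≤ q) ∧ (c ≤ a i ↔ q ≤ b i) := by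
  classical
  cases nonempty_fintype ι
  by_cases h : ∃ i, a i = c
  · obtain ⟨i, rfl⟩ := h
    exact ⟨b i, fun j => ⟨hab j i, hab i j⟩⟩
  · push Not at h
    obtain ⟨q, hlo, hhi⟩ := Order.exists_between_finsets
      (({i | a i < c} : Finset ι).image b) (({i | c < a i} : Finset ι).image b) (by
        simp only [Finset.mem_image, Finset.mem_filter, Finset.mem_univ, true_and]
        rintro _ ⟨i, hi, rfl⟩ _ ⟨j, hj, rfl⟩
        exact lt_of_not_ge fun hji => (hi.trans hj).not_ge ((hab j i).2 hji))
    simp only [Finset.mem_image, Finset.mem_filter, Finset.mem_univ, true_and,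
      forall_exists_index, and_imp, forall_apply_eq_imp_iff₂] at hlo hhi
    refine ⟨q, fun i => ?_⟩
    rcases lt_or_gt_of_ne (h i) with hi | hi
    · exact ⟨iff_of_true hi.le (hlo i hi).le, iff_of_false hi.not_ge (hlo i hi).not_ge⟩
    · exact ⟨iff_of_false hi.not_ge (hhi i hi).not_ge, iff_of_true hi.le (hhi i hi).le⟩

variable {D : Type*} [AddCommGroup D] [LinearOrder D] [IsOrderedAddMonoid D] [Module ℚ D]
  [IsStrictOrderedModule ℚ D]

theorem nonneg_add_smul_iff_of_pos {q : ℚ} (hq : 0 < q) (x y : D) :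
    0 ≤ q • x + y ↔ -(q⁻¹ • y) ≤ x := by
  rw [← smul_le_smul_iff_of_pos_left hq (b₁ := -(q⁻¹ • y)), smul_neg, smul_inv_smul₀ hq.ne',
    neg_le_iff_add_nonneg]

theorem nonneg_add_smul_iff_of_neg {q : ℚ} (hq : q < 0) (x y : D) :
    0 ≤ q • x + y ↔ x ≤ -(q⁻¹ • y) := by
  rw [← smul_le_smul_iff_of_pos_left (neg_pos.2 hq) (b₁ := x), smul_neg, neg_smul, neg_smul,
    smul_inv_smul₀ hq.ne, neg_neg, neg_le_iff_add_nonneg']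

theorem exists_rat_sameSign_fin {n : ℕ} (d : Fin n → D) {Λ : Set (Fin n → ℚ)} (hΛ : Λ.Finite) :
    ∃ q : Fin n → ℚ, SameSign Λ d q := by
  induction n with
  | zero => exact ⟨0, fun l _ => by simp [Fintype.linearCombination_apply]⟩
  | succ n ih =>
    let r : (Fin (n + 1) → ℚ) → (Fin n → ℚ) := fun l => -((l 0)⁻¹ • Fin.tail l)
    obtain ⟨q, hq⟩ := ih (Fin.tail d) (Λ := Fin.tail '' Λ ∪ Set.image2 (fun l l' => r l' - r l) Λ Λ)
      ((hΛ.image _).union (hΛ.image2 _ hΛ))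
    have : Finite Λ := hΛ
    obtain ⟨c, hc⟩ := exists_rat_same_cut (fun l : Λ => evalForm (Fin.tail d) (r l))
      (fun l : Λ => evalForm q (r l)) (fun l l' => by
        have := hq _ (.inr ⟨l, l.2, l', l'.2, rfl⟩)
        simpa only [map_sub, sub_nonneg] using this) (d 0)
    refine ⟨Fin.cons c q, fun l hl => ?_⟩
    rw [evalForm_succ, evalForm_succ, Fin.cons_zero, Fin.tail_cons]
    have hcl := hc ⟨l, hl⟩
    simp only [r, map_neg, map_smul] at hcl
    rcases lt_trichotomy (l 0) 0 with h0 | h0 | h0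
    · rw [nonneg_add_smul_iff_of_neg h0, nonneg_add_smul_iff_of_neg h0]
      exact hcl.2
    · rw [h0, zero_smul, zero_smul, zero_add, zero_add]
      exact hq _ (.inl ⟨l, hl, rfl⟩)
    · rw [nonneg_add_smul_iff_of_pos h0, nonneg_add_smul_iff_of_pos h0]
      exact hcl.1

variable {α : Type*} [Fintype α]

theorem exists_rat_sameSign (d : α → D) {Λ : Set (α → ℚ)} (hΛ : Λ.Finite) :
    ∃ q : α → ℚ, SameSign Λ d q := by
  let σ := Fintype.equivFin α
  obtain ⟨q, hq⟩ := exists_rat_sameSign_fin (d ∘ σ.symm) (hΛ.image (· ∘ σ.symm))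
  refine ⟨q ∘ σ, fun l hl => ?_⟩
  have := hq _ ⟨l, hl, rfl⟩
  simp only [Fintype.linearCombination_apply, Function.comp_apply] at this ⊢
  rw [σ.symm.sum_comp (fun a => l a • d a)] at this
  rw [this, ← σ.sum_comp]
  simp

theorem exists_sameSign (E : Type*) [AddCommGroup E] [LinearOrder E] [IsOrderedAddMonoid E]
    [Module ℚ E] [IsStrictOrderedModule ℚ E] [Nontrivial E] (d : α → D) {Λ : Set (α → ℚ)}
    (hΛ : Λ.Finite) : ∃ e : α → E, SameSign Λ d e := by
  obtain ⟨q, hq⟩ := exists_rat_sameSign d hΛ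
  obtain ⟨ε, hε⟩ := exists_gt (0 : E)
  refine ⟨fun a => q a • ε, fun l hl => ?_⟩
  have : evalForm (fun a => q a • ε) l = evalForm q l • ε := by
    simp [Fintype.linearCombination_apply, Finset.sum_smul, mul_smul]
  rw [this, hq l hl, ← smul_le_smul_iff_of_pos_right hε, zero_smul]

end Transfer

section Representation

variable {G : Type*} [Lattice G] [AddCommGroup G] [AddLeftMono G]

theorem abs_pos_of_ne_zero {a : G} (ha : a ≠ 0) : 0 < |a| := by
  refine lt_of_le_of_ne (abs_nonneg a) fun h => ha ?_
  refine le_antisymm (h ▸ le_abs_self a) (neg_nonpos.1 (h ▸ neg_le_abs a))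

theorem add_inf_le_inf_add_inf {x y w : G} (hx : 0 ≤ x) (hy : 0 ≤ y) (hw : 0 ≤ w) :
    (x + y) ⊓ w ≤ x ⊓ w + y ⊓ w := by
  rw [← sub_le_iff_le_add, sub_eq_add_neg, neg_inf, add_sup, sup_le_iff, ← sub_eq_add_neg,
    ← sub_eq_add_neg]
  exact ⟨le_inf (sub_le_iff_le_add.2 inf_le_left) ((sub_le_self _ hy).trans inf_le_right),
    (sub_nonpos.2 inf_le_right).trans (le_inf hx hw)⟩

/-- The elements disjoint from some member of a set of positive elements closed under meets. -/
def disjointSubgroup (U : Set G) (hne : U.Nonempty) (hpos : ∀ u ∈ U, 0 < u)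
    (hinf : ∀ u ∈ U, ∀ v ∈ U, u ⊓ v ∈ U) : AddSubgroup G where
  carrier := {g | ∃ u ∈ U, |g| ⊓ u ≤ 0}
  zero_mem' := hne.imp fun u hu => ⟨hu, by simp⟩
  add_mem' := by
    rintro g h ⟨u, hu, hgu⟩ ⟨v, hv, hhv⟩
    refine ⟨u ⊓ v, hinf u hu v hv, ?_⟩
    calc |g + h| ⊓ (u ⊓ v) ≤ (|g| + |h|) ⊓ (u ⊓ v) := inf_le_inf_right _ (abs_add_le g h)
      _ ≤ |g| ⊓ (u ⊓ v) + |h| ⊓ (u ⊓ v) :=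
        add_inf_le_inf_add_inf (abs_nonneg g) (abs_nonneg h) (hpos _ (hinf u hu v hv)).le
      _ ≤ 0 := add_nonpos ((inf_le_inf_left _ inf_le_left).trans hgu)
        ((inf_le_inf_left _ inf_le_right).trans hhv)
  neg_mem' := by
    rintro g ⟨u, hu, h⟩
    exact ⟨u, hu, by rwa [abs_neg]⟩

/-- A subgroup of an abelian ℓ-group that is convex and prime, so that the quotient is
totally ordered. -/
structure IsPrimeConvex (P : AddSubgroup G) : Prop where
  convex : ∀ g h, 0 ≤ g → g ≤ h → h ∈ P → g ∈ P
  prime : ∀ g : G, g⁺ ∈ P ∨ g⁻ ∈ P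

theorem exists_isPrimeConvex_notMem {a : G} (ha : a ≠ 0) :
    ∃ P : AddSubgroup G, IsPrimeConvex P ∧ a ∉ P := by
  let S : Set (Set G) := {U | (∀ u ∈ U, 0 < u) ∧ ∀ u ∈ U, ∀ v ∈ U, u ⊓ v ∈ U}
  obtain ⟨U, hsub, hU⟩ := zorn_subset_nonempty S (by
    intro c hc hchain _
    refine ⟨⋃₀ c, ⟨?_, ?_⟩, fun s hs => Set.subset_sUnion_of_mem hs⟩
    · rintro u ⟨V, hV, hu⟩
      exact (hc hV).1 u hu
    · rintro u ⟨V, hV, hu⟩ v ⟨W, hW, hv⟩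
      rcases hchain.total hV hW with h | h
      · exact ⟨W, hW, (hc hW).2 u (h hu) v hv⟩
      · exact ⟨V, hV, (hc hV).2 u hu v (h hv)⟩) {|a|} (by
    constructor
    · rintro u rfl
      exact abs_pos_of_ne_zero ha
    · rintro u rfl v rfl
      exact inf_idem _)
  have haU : |a| ∈ U := hsub rfl
  obtain ⟨hpos, hinf⟩ := hU.prop
  have key : ∀ g : G, 0 ≤ g → (∀ u ∈ U, g ⊓ u ≠ 0) → g ∈ U := fun g hg hgU => by
    have hmem : {h | ∃ u ∈ U, g ⊓ u ≤ h} ∈ S := by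
      constructor
      · rintro h ⟨u, hu, hle⟩
        exact (lt_of_le_of_ne (le_inf hg (hpos u hu).le) (hgU u hu).symm).trans_le hle
      · rintro h ⟨u, hu, hle⟩ k ⟨v, hv, hle'⟩
        exact ⟨u ⊓ v, hinf u hu v hv, le_inf ((inf_le_inf_left _ inf_le_left).trans hle)
          ((inf_le_inf_left _ inf_le_right).trans hle')⟩
    exact hU.le_of_ge hmem (fun u hu => ⟨u, hu, inf_le_right⟩) ⟨|a|, haU, inf_le_left⟩
  refine ⟨disjointSubgroup U ⟨_, haU⟩ hpos hinf, ⟨?_, fun g => ?_⟩, ?_⟩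
  · rintro g h hg hgh ⟨u, hu, hle⟩
    refine ⟨u, hu, le_trans (inf_le_inf_right _ ?_) hle⟩
    rw [abs_of_nonneg hg]
    exact hgh.trans (le_abs_self h)
  · by_cases hg : g⁺ ∈ U
    · right
      refine ⟨g⁺, hg, ?_⟩
      rw [abs_of_nonneg (negPart_nonneg g), inf_comm, posPart_inf_negPart_eq_zero]
    · left
      by_contra hP
      refine hg (key _ (posPart_nonneg g) fun u hu h => hP ⟨u, hu, ?_⟩)
      rw [abs_of_nonneg (posPart_nonneg g), h]
  · rintro ⟨u, hu, hle⟩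
    exact (hpos _ (hinf _ haU u hu)).not_ge hle

/-- The positive cone of the quotient by a convex subgroup. -/
def quotientCone (P : AddSubgroup G) (hP : IsPrimeConvex P) : AddGroupCone (G ⧸ P) where
  carrier := {q | ∃ g : G, 0 ≤ g ∧ (g : G ⧸ P) = q}
  zero_mem' := ⟨0, le_rfl, rfl⟩
  add_mem' := by
    rintro _ _ ⟨g, hg, rfl⟩ ⟨h, hh, rfl⟩
    exact ⟨g + h, add_nonneg hg hh, rfl⟩
  eq_zero_of_mem_of_neg_mem' := by
    rintro _ ⟨g, hg, rfl⟩ ⟨h, hh, hgh⟩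
    rw [QuotientAddGroup.eq_zero_iff]
    refine hP.convex g (g + h) hg (le_add_of_nonneg_right hh) ?_
    rw [← QuotientAddGroup.eq_zero_iff, QuotientAddGroup.mk_add, hgh, add_neg_cancel]

theorem exists_surjective_linear.{u} {G : Type u} [Lattice G] [AddCommGroup G] [AddLeftMono G]
    {a : G} (ha : a ≠ 0) :
    ∃ (C : Type u) (_ : AddCommGroup C) (_ : LinearOrder C) (_ : IsOrderedAddMonoid C)
      (f : G →+ C), Function.Surjective f ∧ (∀ x y, f (x ⊔ y) = f x ⊔ f y) ∧ f a ≠ 0 := by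
  classical
  obtain ⟨P, hP, haP⟩ := exists_isPrimeConvex_notMem ha
  have : HasMemOrNegMem (quotientCone P hP) := ⟨fun q => by
    obtain ⟨g, rfl⟩ := QuotientAddGroup.mk_surjective q
    have e : g⁺ = g + g⁻ := sub_eq_iff_eq_add.1 (posPart_sub_negPart g)
    rcases hP.prime g with h | h
    · right
      refine ⟨g⁻, negPart_nonneg g, ?_⟩
      rw [← QuotientAddGroup.mk_neg, QuotientAddGroup.eq,
        (by rw [e, neg_add_rev] : -g⁻ + -g = -g⁺)]
      exact neg_mem h
    · left
      refine ⟨g⁺, posPart_nonneg g, ?_⟩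
      rw [QuotientAddGroup.eq, (by rw [e]; abel : -g⁺ + g = -g⁻)]
      exact neg_mem h⟩
  let _ : LinearOrder (G ⧸ P) := LinearOrder.mkOfAddGroupCone (quotientCone P hP)
  have : IsOrderedAddMonoid (G ⧸ P) := IsOrderedAddMonoid.mkOfCone (quotientCone P hP)
  have hmono : Monotone (QuotientAddGroup.mk' P) := fun x y hxy =>
    show _ ∈ quotientCone P hP from ⟨y - x, sub_nonneg.2 hxy, rfl⟩
  have hker : ∀ {g : G}, g ∈ P → QuotientAddGroup.mk' P g = 0 := fun h =>
    (QuotientAddGroup.eq_zero_iff _).2 h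
  refine ⟨G ⧸ P, inferInstance, inferInstance, inferInstance, QuotientAddGroup.mk' P,
    QuotientAddGroup.mk'_surjective P, fun x y => ?_, fun h => haP ?_⟩
  · refine le_antisymm ?_ (sup_le (hmono le_sup_left) (hmono le_sup_right))
    rcases hP.prime (x - y) with h | h
    · rw [sup_eq_add_posPart_sub, map_add, hker h, add_zero]
      exact le_max_right _ _
    · rw [sup_comm, sup_eq_add_posPart_sub, ← neg_sub x y, posPart_neg, map_add, hker h,
        add_zero]
      exact le_max_left _ _
  · exact (QuotientAddGroup.eq_zero_iff a).1 h

end Representation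

section Hull

/-- Any nonzero element of an abelian ℓ-group survives in some totally ordered `ℚ`-vector space. -/
theorem exists_map_ne_zero {G : Type} [Lattice G] [AddCommGroup G] [AddLeftMono G] {a : G}
    (ha : a ≠ 0) :
    ∃ (D : Type) (_ : AddCommGroup D) (_ : LinearOrder D) (_ : IsOrderedAddMonoid D)
      (_ : Module ℚ D) (_ : IsStrictOrderedModule ℚ D) (f : G →+ D),
      (∀ x y, f (x ⊔ y) = f x ⊔ f y) ∧ f a ≠ 0 := by
  obtain ⟨C, _, _, _, f, -, hsup, hfa⟩ := exists_surjective_linear ha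
  let g := DivisibleHull.coeOrderAddMonoidHom C
  refine ⟨DivisibleHull C, inferInstance, inferInstance, inferInstance, inferInstance,
    inferInstance, (g : C →+ DivisibleHull C).comp f, fun x y => ?_, ?_⟩
  · exact (congrArg g (hsup x y)).trans (g.monotone'.map_sup _ _)
  · exact fun h => hfa (DivisibleHull.coe_injective (h.trans (map_zero g).symm))

/-- The tuple `z` solves the system `φ` for the input `x`. -/
def Solves (φ : EFDSystem LGrpLang) {G : Type*} [Lattice G] [AddCommGroup G]
    (x : Fin φ.n → G) (z : Fin φ.m → G) : Prop :=
  ∀ i, (φ.lhs i).realize (Sum.elim x z) = (φ.rhs i).realize (Sum.elim x z)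

theorem Solves.map {φ : EFDSystem LGrpLang} {G H : Type*} [Lattice G] [AddCommGroup G]
    [AddLeftMono G] [Lattice H] [AddCommGroup H] [AddLeftMono H] (f : G →+ H)
    (hf : ∀ a b, f (a ⊔ b) = f a ⊔ f b) {x : Fin φ.n → G} {z : Fin φ.m → G}
    (h : Solves φ x z) : Solves φ (f ∘ x) (f ∘ z) := fun i => by
  rw [← Sum.comp_elim, realize_comp_of_map_sup _ _ f hf, realize_comp_of_map_sup _ _ f hf, h i]

theorem exists_hull_common_denom {C ι : Type*} [Finite ι] [AddCommGroup C] [LinearOrder C]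
    [IsOrderedAddMonoid C] (x : ι → DivisibleHull C) :
    ∃ N : ℕ, 0 < N ∧ ∃ y : ι → C, ∀ i, (N : ℚ) • x i = DivisibleHull.coe (y i) := by
  cases nonempty_fintype ι
  have : ∀ i, ∃ (c : C) (s : ℕ+), x i = DivisibleHull.mk c s := fun i => by
    induction x i with | mk c s => exact ⟨c, s, rfl⟩
  choose c s hx using this
  refine ⟨∏ i, (s i : ℕ), Finset.prod_pos fun i _ => (s i).pos, ?_⟩
  have hdvd : ∀ i, ∃ k, ∏ i, (s i : ℕ) = s i * k := fun i =>
    Finset.dvd_prod_of_mem _ (Finset.mem_univ i)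
  choose k hk using hdvd
  refine ⟨fun i => k i • c i, fun i => ?_⟩
  rw [hk i, hx, Nat.cast_smul_eq_nsmul, DivisibleHull.nsmul_mk]
  rw [DivisibleHull.mk_eq_mk_iff_smul_eq_smul]
  simp [mul_smul]

theorem exists_rat_space_solvable {φ : EFDSystem LGrpLang} {A : Type} [Lattice A]
    [AddCommGroup A] [AddLeftMono A] [Nontrivial A] (hA : φ.Satisfies A) :
    ∃ (D : Type) (_ : AddCommGroup D) (_ : LinearOrder D) (_ : IsOrderedAddMonoid D)
      (_ : Module ℚ D) (_ : IsStrictOrderedModule ℚ D), Nontrivial D ∧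
      ∀ x : Fin φ.n → D, ∃ z : Fin φ.m → D, Solves φ x z := by
  obtain ⟨a, ha⟩ := exists_ne (0 : A)
  obtain ⟨C, _, _, _, f, hsurj, hsup, hfa⟩ := exists_surjective_linear ha
  refine ⟨DivisibleHull C, inferInstance, inferInstance, inferInstance, inferInstance,
    inferInstance, ⟨DivisibleHull.coe (f a), 0, fun h => hfa ?_⟩, fun x => ?_⟩
  · exact DivisibleHull.coe_injective (h.trans (DivisibleHull.mk_zero 1).symm)
  obtain ⟨N, hN, y, hy⟩ := exists_hull_common_denom x
  have hN0 : (0 : ℚ) < N := Nat.cast_pos.2 hN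
  choose w hw using fun i => hsurj (y i)
  obtain ⟨z, hz, -⟩ := hA w
  let g : C →+ DivisibleHull C :=
    (DistribSMul.toAddMonoidHom (DivisibleHull C) ((N : ℚ)⁻¹)).comp
      (DivisibleHull.coeAddMonoidHom C)
  have hg : Monotone g := fun b c hbc =>
    smul_le_smul_of_nonneg_left ((DivisibleHull.coeOrderAddMonoidHom C).monotone' hbc)
      (inv_pos.2 hN0).le
  have hgx : g ∘ f ∘ w = x := by
    funext i
    change (N : ℚ)⁻¹ • DivisibleHull.coe (f (w i)) = x i
    rw [hw, ← hy, inv_smul_smul₀ hN0.ne']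
  have hz : Solves φ w z := hz
  exact ⟨_, hgx ▸ (hz.map f hsup).map g hg.map_sup⟩

end Hull

section EquationTransfer

theorem exists_common_denom {α : Type*} [Finite α] (q : α → ℚ) :
    ∃ N : ℕ, 0 < N ∧ ∃ p : α → ℤ, ∀ a, (p a : ℚ) = N * q a := by
  cases nonempty_fintype α
  refine ⟨∏ a, (q a).den, Finset.prod_pos fun a _ => (q a).den_pos, ?_⟩
  have hdvd : ∀ a, ∃ k, ∏ a, (q a).den = (q a).den * k := fun a =>
    Finset.dvd_prod_of_mem _ (Finset.mem_univ a)
  choose k hk using hdvd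
  refine ⟨fun a => k a * (q a).num, fun a => ?_⟩
  rw [hk]
  push_cast
  rw [mul_comm ((q a).den : ℚ), mul_assoc, mul_comm ((q a).den : ℚ), Rat.mul_den_eq_num]

theorem realize_comp_eq_iff {α G H : Type*} [Lattice G] [AddCommGroup G] [AddLeftMono G]
    [Lattice H] [AddCommGroup H] [AddLeftMono H] (f : G →+ H) (hf : ∀ a b, f (a ⊔ b) = f a ⊔ f b)
    (hinj : Function.Injective f) (v : α → G) (s t : LGrpLang.Term α) :
    s.realize (f ∘ v) = t.realize (f ∘ v) ↔ s.realize v = t.realize v := by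
  rw [realize_comp_of_map_sup _ _ f hf, realize_comp_of_map_sup _ _ f hf, hinj.eq_iff]

/-- Any finite pattern of equations and inequations realized in a totally ordered `ℚ`-vector
space is realized in every nontrivial abelian ℓ-group. -/
theorem exists_same_equations {D : Type} [AddCommGroup D] [LinearOrder D] [IsOrderedAddMonoid D]
    [Module ℚ D] [IsStrictOrderedModule ℚ D] (A : Type*) [Lattice A] [AddCommGroup A]
    [AddLeftMono A] [Nontrivial A] {α ι : Type*} [Fintype α] [Finite ι]
    (s t : ι → LGrpLang.Term α) (d : α → D) :
    ∃ e : α → A, ∀ i, (s i).realize d = (t i).realize d ↔ (s i).realize e = (t i).realize e := by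
  obtain ⟨Λ, hΛ, h⟩ := exists_forms_deciding s t
  obtain ⟨q, hq⟩ := exists_rat_sameSign d hΛ
  obtain ⟨N, hN, p, hp⟩ := exists_common_denom q
  obtain ⟨a, ha⟩ := exists_ne (0 : A)
  have hpos := abs_pos_of_ne_zero ha
  let f : ℤ →+ A := zmultiplesHom A |a|
  have hmono : StrictMono f := fun b c hbc => by
    have : 0 < (c - b) • |a| := zsmul_pos hpos (sub_pos.2 hbc)
    simpa [f, sub_smul] using this
  refine ⟨f ∘ p, fun i => ?_⟩
  rw [realize_comp_eq_iff f hmono.monotone.map_sup hmono.injective, h D ℚ d q hq i]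
  have hNmono : StrictMono (AddMonoidHom.mulLeft (N : ℚ)) := fun b c hbc =>
    mul_lt_mul_of_pos_left hbc (by positivity)
  rw [← realize_comp_eq_iff (AddMonoidHom.mulLeft (N : ℚ)) hNmono.monotone.map_sup
    hNmono.injective]
  have hcast : StrictMono (Int.castAddHom ℚ) := fun b c hbc => Int.cast_lt.2 hbc
  rw [← realize_comp_eq_iff (Int.castAddHom ℚ) hcast.monotone.map_sup hcast.injective]
  rw [show Int.castAddHom ℚ ∘ p = AddMonoidHom.mulLeft (N : ℚ) ∘ q from funext hp]

end EquationTransfer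

section Uniqueness

variable {φ : EFDSystem LGrpLang}

theorem Solves.unique {A : Type*} [Lattice A] [AddCommGroup A] [AddLeftMono A] [Nontrivial A]
    (hA : φ.Satisfies A) {D : Type} [AddCommGroup D] [LinearOrder D] [IsOrderedAddMonoid D]
    [Module ℚ D] [IsStrictOrderedModule ℚ D] {x : Fin φ.n → D} {z z' : Fin φ.m → D}
    (h : Solves φ x z) (h' : Solves φ x z') : z = z' := by
  let u : Fin φ.n ⊕ Fin φ.m → Fin φ.n ⊕ (Fin φ.m ⊕ Fin φ.m) := Sum.map id Sum.inl
  let u' : Fin φ.n ⊕ Fin φ.m → Fin φ.n ⊕ (Fin φ.m ⊕ Fin φ.m) := Sum.map id Sum.inr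
  let pairs (s : Fin φ.r → LGrpLang.Term (Fin φ.n ⊕ Fin φ.m)) (v : Fin φ.m → Fin φ.m ⊕ Fin φ.m) :
      Fin φ.r ⊕ Fin φ.r ⊕ Fin φ.m → LGrpLang.Term (Fin φ.n ⊕ (Fin φ.m ⊕ Fin φ.m)) :=
    Sum.elim (fun i => (s i).relabel u)
      (Sum.elim (fun i => (s i).relabel u') fun j => Term.var (Sum.inr (v j)))
  obtain ⟨e, he⟩ := exists_same_equations A (pairs φ.lhs Sum.inl) (pairs φ.rhs Sum.inr)
    (Sum.elim x (Sum.elim z z'))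
  simp only [pairs, Sum.forall, Sum.elim_inl, Sum.elim_inr, Term.realize_relabel,
    Term.realize_var] at he
  obtain ⟨h₁, h₂, h₃⟩ := he
  have hd : Sum.elim x (Sum.elim z z') ∘ u = Sum.elim x z := by ext (i | j) <;> rfl
  have hd' : Sum.elim x (Sum.elim z z') ∘ u' = Sum.elim x z' := by ext (i | j) <;> rfl
  have hu : e ∘ u = Sum.elim (e ∘ Sum.inl) (e ∘ Sum.inr ∘ Sum.inl) := by ext (i | j) <;> rfl
  have hu' : e ∘ u' = Sum.elim (e ∘ Sum.inl) (e ∘ Sum.inr ∘ Sum.inr) := by ext (i | j) <;> rfl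
  simp only [hd, hd', hu, hu'] at h₁ h₂
  have := (hA (e ∘ Sum.inl)).unique (fun i => (h₁ i).1 (h i)) (fun i => (h₂ i).1 (h' i))
  exact funext fun j => (h₃ j).2 (congrFun this j)

end Uniqueness

section Perturbation

variable {D : Type*} [AddCommGroup D] [LinearOrder D] [IsOrderedAddMonoid D] [Module ℚ D]
  [IsStrictOrderedModule ℚ D]

theorem nonneg_add_smul_iff_of_small {v ε : D} {c : ℚ} (hε : 0 < ε) (hv : v = 0 → c = 0)
    (h : v ≠ 0 → ε ≤ (|c| + 1)⁻¹ • |v|) : 0 ≤ v ↔ 0 ≤ v + c • ε := by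
  rcases eq_or_ne v 0 with rfl | hne
  · simp [hv rfl]
  have hc : 0 < |c| + 1 := by positivity
  have h₁ : (|c| + 1) • ε ≤ |v| := by
    rw [← smul_inv_smul₀ hc.ne' |v|]
    exact smul_le_smul_of_nonneg_left (h hne) hc.le
  have h₂ : c • ε < (|c| + 1) • ε :=
    smul_lt_smul_of_pos_right ((le_abs_self c).trans_lt (lt_add_one _)) hε
  have h₃ : (-c) • ε < (|c| + 1) • ε :=
    smul_lt_smul_of_pos_right ((neg_le_abs c).trans_lt (lt_add_one _)) hε
  rw [neg_smul] at h₃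
  rcases lt_or_gt_of_ne hne with hv | hv
  · rw [abs_of_neg hv] at h₁
    exact iff_of_false hv.not_ge (not_le.2 (by simpa using add_lt_add_right (h₂.trans_le h₁) v))
  · rw [abs_of_pos hv] at h₁
    exact iff_of_true hv.le (neg_le_iff_add_nonneg.1 (h₃.trans_le h₁).le)

theorem exists_pos_sameSign_add {α : Type*} [Fintype α] [DecidableEq α] [Nontrivial D] (d : α → D)
    {Λ : Set (α → ℚ)} (hΛ : Λ.Finite) (ω : (α → ℚ) →ₗ[ℚ] ℚ)
    (hω : ∀ l ∈ Λ, evalForm d l = 0 → ω l = 0) :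
    ∃ ε : D, 0 < ε ∧ SameSign Λ d (fun a => d a + ω (Pi.single a 1) • ε) := by
  have : Nonempty {ε : D // 0 < ε} := nonempty_subtype.2 (exists_gt (0 : D))
  have hsmall : ∀ l : Λ, ∃ δ : {ε : D // 0 < ε},
      evalForm d l.1 ≠ 0 → (δ : D) ≤ (|ω l| + 1)⁻¹ • |evalForm d l.1| := fun l => by
    by_cases h : evalForm d l.1 = 0
    · exact ⟨Classical.arbitrary _, fun h' => (h' h).elim⟩
    · exact ⟨⟨_, smul_pos (by positivity) (abs_pos.2 h)⟩, fun _ => le_rfl⟩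
  choose δ hδ using hsmall
  have : Finite Λ := hΛ
  obtain ⟨ε, hε⟩ := (Set.finite_range δ).bddBelow
  refine ⟨ε, ε.2, fun l hl => ?_⟩
  have hωl : ω l = ∑ a, l a * ω (Pi.single a 1) := by
    conv_lhs => rw [pi_eq_sum_univ' l, map_sum]
    exact Finset.sum_congr rfl fun a _ => by rw [map_smul, smul_eq_mul]
  have heval : evalForm (fun a => d a + ω (Pi.single a 1) • (ε : D)) l
      = evalForm d l + ω l • (ε : D) := by
    simp only [Fintype.linearCombination_apply, smul_add, Finset.sum_add_distrib, hωl,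
      Finset.sum_smul, mul_smul]
  rw [heval]
  refine nonneg_add_smul_iff_of_small ε.2 (hω l hl) fun h => le_trans ?_ (hδ ⟨l, hl⟩ h)
  exact hε ⟨⟨l, hl⟩, rfl⟩

end Perturbation

section Cover

variable {φ : EFDSystem LGrpLang} {α β : Type*} [Fintype α] [Fintype β]

theorem evalForm_sumElim {D : Type*} [AddCommGroup D] [Module ℚ D] (x : α → D) (z : β → D)
    (l : α ⊕ β → ℚ) :
    evalForm (Sum.elim x z) l = evalForm x (l ∘ Sum.inl) + evalForm z (l ∘ Sum.inr) := by
  simp [Fintype.linearCombination_apply]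

theorem exists_forms_solving {D : Type} [AddCommGroup D] [LinearOrder D] [IsOrderedAddMonoid D]
    [Module ℚ D] [IsStrictOrderedModule ℚ D] [Nontrivial D]
    (hex : ∀ x : Fin φ.n → D, ∃ z, Solves φ x z)
    (huniq : ∀ (x : Fin φ.n → D) z z', Solves φ x z → Solves φ x z' → z = z') :
    ∃ Γ : Set (Fin φ.m → Fin φ.n → ℚ), Γ.Finite ∧
      ∀ x : Fin φ.n → D, ∃ γ ∈ Γ, Solves φ x fun j => evalForm x (γ j) := by
  classical
  obtain ⟨Λ, hΛ, hdec⟩ := exists_forms_deciding φ.lhs φ.rhs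
  let ι : (Fin φ.n → ℚ) →ₗ[ℚ] (Fin φ.n ⊕ Fin φ.m → ℚ) :=
    { toFun := fun l => Sum.elim l 0
      map_add' := fun l l' => by ext (i | j) <;> simp
      map_smul' := fun c l => by ext (i | j) <;> simp }
  let v (j : Fin φ.m) : Fin φ.n ⊕ Fin φ.m → ℚ := Pi.single (Sum.inr j) 1
  let γ (E : Set (Fin φ.n ⊕ Fin φ.m → ℚ)) : Fin φ.m → Fin φ.n → ℚ :=
    if h : ∃ γ : Fin φ.m → Fin φ.n → ℚ, ∀ j, v j - ι (γ j) ∈ Submodule.span ℚ E then h.choose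
    else 0
  refine ⟨γ '' {E | E ⊆ Λ}, hΛ.finite_subsets.image _, fun x => ?_⟩
  obtain ⟨z, hz⟩ := hex x
  let d := Sum.elim x z
  let E := {l ∈ Λ | evalForm d l = 0}
  have hE : Submodule.span ℚ E ≤ LinearMap.ker (evalForm d) :=
    Submodule.span_le.2 fun l hl => hl.2
  have key : ∀ j, ∃ g, v j - ι g ∈ Submodule.span ℚ E := fun j => by
    by_contra hcon
    have hmem : v j ∉ Submodule.span ℚ E ⊔ LinearMap.range ι := fun h => by
      obtain ⟨y, hy, _, ⟨g, rfl⟩, hyz⟩ := Submodule.mem_sup.1 h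
      exact hcon ⟨g, by rwa [← hyz, add_sub_cancel_right]⟩
    obtain ⟨ω, hωv, hω⟩ := Submodule.exists_le_ker_of_notMem hmem
    obtain ⟨ε, hε, hsame⟩ := exists_pos_sameSign_add d hΛ ω fun l hl h0 =>
      hω (Submodule.mem_sup_left (Submodule.subset_span ⟨hl, h0⟩))
    have hd' : (fun a => d a + ω (Pi.single a 1) • ε)
        = Sum.elim x fun j => z j + ω (v j) • ε := by
      ext (i | j)
      · have : (Pi.single (Sum.inl i) 1 : Fin φ.n ⊕ Fin φ.m → ℚ) = ι (Pi.single i 1) :=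
          (Sum.elim_single_zero i 1).symm
        have h0 : ω (ι (Pi.single i 1)) = 0 := hω (Submodule.mem_sup_right ⟨_, rfl⟩)
        simp [d, this, h0]
      · rfl
    rw [hd'] at hsame
    have := huniq x z _ hz fun i => (hdec D D d _ hsame i).1 (hz i)
    have := congrFun this j
    rw [left_eq_add, smul_eq_zero] at this
    exact this.elim hωv hε.ne'
  choose g hg using key
  have hγ : ∀ j, v j - ι (γ E j) ∈ Submodule.span ℚ E := by
    have h : ∃ γ : Fin φ.m → Fin φ.n → ℚ, ∀ j, v j - ι (γ j) ∈ Submodule.span ℚ E := ⟨g, hg⟩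
    simp only [γ, dif_pos h]
    exact h.choose_spec
  refine ⟨γ E, ⟨E, fun l hl => hl.1, rfl⟩, ?_⟩
  convert hz using 2 with j
  have := hE (hγ j)
  rw [LinearMap.mem_ker, map_sub, sub_eq_zero, evalForm_single, evalForm_sumElim] at this
  simpa [d, ι] using this.symm

theorem forms_solving_transfer {D : Type} [AddCommGroup D] [LinearOrder D] [IsOrderedAddMonoid D]
    [Module ℚ D] [IsStrictOrderedModule ℚ D] [Nontrivial D] {Γ : Set (Fin φ.m → Fin φ.n → ℚ)}
    (hΓ : Γ.Finite) (h : ∀ x : Fin φ.n → D, ∃ γ ∈ Γ, Solves φ x fun j => evalForm x (γ j))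
    {E : Type} [AddCommGroup E] [LinearOrder E] [IsOrderedAddMonoid E] [Module ℚ E]
    [IsStrictOrderedModule ℚ E] (x : Fin φ.n → E) :
    ∃ γ ∈ Γ, Solves φ x fun j => evalForm x (γ j) := by
  obtain ⟨Λ, hΛ, hdec⟩ := exists_forms_deciding φ.lhs φ.rhs
  let σ (γ : Fin φ.m → Fin φ.n → ℚ) (l : Fin φ.n ⊕ Fin φ.m → ℚ) : Fin φ.n → ℚ :=
    l ∘ Sum.inl + ∑ j, l (Sum.inr j) • γ j
  have hσ : ∀ {F : Type} [AddCommGroup F] [Module ℚ F] (x : Fin φ.n → F) γ l,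
      evalForm (Sum.elim x fun j => evalForm x (γ j)) l = evalForm x (σ γ l) :=
    fun x γ l => by
      rw [evalForm_sumElim, map_add, map_sum,
        Fintype.linearCombination_apply ℚ (fun j => evalForm x (γ j))]
      simp only [map_smul, Function.comp_apply]
  obtain ⟨y, hy⟩ := exists_sameSign D x (hΓ.image2 σ hΛ)
  obtain ⟨γ, hγ, hsol⟩ := h y
  refine ⟨γ, hγ, fun i => (hdec E D _ _ (fun l hl => ?_) i).2 (hsol i)⟩
  rw [hσ, hσ]
  exact hy _ ⟨γ, hγ, l, hl, rfl⟩

end Cover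

section Interpolation

theorem exists_mem_inter_nonempty_of_mem_closure {X ι : Type*} [TopologicalSpace X] [Finite ι]
    {T : ι → Set X} (hT : ∀ i, IsClosed (T i)) (hcov : ∀ t, ∃ i, t ∈ T i) {S : Set X} {τ : X}
    (hτ : τ ∈ closure S) : ∃ i, τ ∈ closure (T i ∩ S) ∧ τ ∈ T i ∧ (T i ∩ S).Nonempty := by
  have hS : S = ⋃ i, T i ∩ S := by
    rw [← Set.iUnion_inter, Set.iUnion_eq_univ_iff.2 hcov, Set.univ_inter]
  rw [hS, closure_iUnion_of_finite, Set.mem_iUnion] at hτ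
  obtain ⟨i, hi⟩ := hτ
  exact ⟨i, hi, (hT i).closure_subset_iff.2 Set.inter_subset_left hi,
    closure_nonempty_iff.1 ⟨τ, hi⟩⟩

/-- A function which is affine on each member of a finite closed cover of the line has a piece
lying weakly below it at `0` and weakly above it at `1`. -/
theorem exists_affine_piece {ι : Type*} [Finite ι] {T : ι → Set ℝ} (hT : ∀ i, IsClosed (T i))
    (hcov : ∀ t, ∃ i, t ∈ T i) (a b : ι → ℝ) (F : ℝ → ℝ)
    (hF : ∀ i, ∀ t ∈ T i, F t = a i + t * b i) : ∃ i, a i ≤ F 0 ∧ F 1 ≤ a i + b i := by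
  let C : Set ℝ := {t | (0 ≤ t ∧ t < 1) ∧ F t ≤ F 0 + t * (F 1 - F 0)}
  have h0 : (0 : ℝ) ∈ C := ⟨⟨le_rfl, one_pos⟩, by simp⟩
  have hbdd : BddAbove C := ⟨1, fun t ht => ht.1.2.le⟩
  have hτ0 : 0 ≤ sSup C := le_csSup hbdd h0
  have hτ1 : sSup C ≤ 1 := csSup_le ⟨0, h0⟩ fun t ht => ht.1.2.le
  obtain ⟨i, hcl, hi, t, hti, htC⟩ :=
    exists_mem_inter_nonempty_of_mem_closure hT hcov (csSup_mem_closure ⟨0, h0⟩ hbdd)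
  rcases hτ1.eq_or_lt with h1 | h1
  · rw [h1] at hi
    refine ⟨i, ?_⟩
    have e1 := hF i 1 hi
    have et := hF i t hti
    have := htC.2
    have := htC.1.2
    constructor <;> nlinarith
  · have hτ : F (sSup C) ≤ F 0 + sSup C * (F 1 - F 0) := by
      rw [hF i _ hi]
      have hclosed : IsClosed {t : ℝ | a i + t * b i ≤ F 0 + t * (F 1 - F 0)} :=
        isClosed_le (by fun_prop) (by fun_prop)
      refine closure_minimal (fun t ht => ?_) hclosed hcl
      rw [Set.mem_ofPred_eq, ← hF i t ht.1]
      exact ht.2.2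
    have hmem : sSup C ∈ closure (Set.Ioo (sSup C) 1) := by
      rw [closure_Ioo h1.ne]
      exact Set.left_mem_Icc.2 h1.le
    obtain ⟨k, -, hk, s, hsk, hs0, hs1⟩ := exists_mem_inter_nonempty_of_mem_closure hT hcov hmem
    have hs : F 0 + s * (F 1 - F 0) < F s := by
      by_contra! h
      exact hs0.not_ge (le_csSup hbdd ⟨⟨hτ0.trans hs0.le, hs1⟩, h⟩)
    rw [hF k _ hk] at hτ
    rw [hF k s hsk] at hs
    have hslope : 0 < b k - (F 1 - F 0) := by
      by_contra! h
      nlinarith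
    exact ⟨k, by nlinarith, by nlinarith⟩

/-- A lattice of real functions contains every function that is interpolated from below and
above, at any two points, by members of a finite subset. -/
theorem mem_of_forall_exists_le_and_le {X : Type*} [Nonempty X] {L Γ : Set (X → ℝ)}
    (hsup : SupClosed L) (hinf : InfClosed L) (hΓ : Γ.Finite) (hΓL : Γ ⊆ L) {F : X → ℝ}
    (h : ∀ x y, ∃ g ∈ Γ, g x ≤ F x ∧ F y ≤ g y) : F ∈ L := by
  have hM : {m ∈ infClosure Γ | m ≤ F}.Finite := hΓ.infClosure.subset fun m hm => hm.1
  have key : ∀ y, ∃ m ∈ hM.toFinset, F y ≤ m y := fun y => by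
    let B := {g ∈ Γ | F y ≤ g y}
    have hB : B.Finite := hΓ.subset fun g hg => hg.1
    have hne : hB.toFinset.Nonempty := by
      obtain ⟨g, hg, -, hgy⟩ := h y y
      exact ⟨g, hB.mem_toFinset.2 ⟨hg, hgy⟩⟩
    refine ⟨hB.toFinset.inf' hne id, hM.mem_toFinset.2 ⟨?_, fun x => ?_⟩, ?_⟩
    · exact finsetInf'_mem_infClosure hne fun g hg => (hB.mem_toFinset.1 hg).1
    · obtain ⟨g, hg, hgx, hgy⟩ := h x y
      exact le_trans (Finset.inf'_le id (hB.mem_toFinset.2 ⟨hg, hgy⟩) x) hgx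
    · rw [Finset.inf'_apply]
      exact Finset.le_inf' _ _ fun g hg => (hB.mem_toFinset.1 hg).2
  have hne : hM.toFinset.Nonempty := (key (Classical.arbitrary X)).imp fun m hm => hm.1
  have hF : F = hM.toFinset.sup' hne id := by
    refine le_antisymm (fun y => ?_) (Finset.sup'_le _ _ fun m hm => (hM.mem_toFinset.1 hm).2)
    obtain ⟨m, hm, hy⟩ := key y
    exact hy.trans (Finset.le_sup' id hm y)
  rw [hF]
  exact hsup.finsetSup'_mem hne fun m hm => infClosure_min hΓL hinf (hM.mem_toFinset.1 hm).1

end Interpolation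

section Real

variable {α : Type*} {φ : EFDSystem LGrpLang}

theorem continuous_realize (t : LGrpLang.Term α) :
    Continuous fun x : α → ℝ => t.realize x := by
  induction t using term_induction with
  | var a => exact continuous_apply a
  | zero => exact continuous_const
  | neg s hs => exact hs.neg
  | bin f s t hs ht =>
    cases f
    · exact hs.add ht
    · exact hs.sup ht
    · exact hs.inf ht

/-- The real functions given by the terms of the language. -/
def termFunctions (α : Type*) : AddSubgroup ((α → ℝ) → ℝ) where
  carrier := {F | ∃ t : LGrpLang.Term α, ∀ x, t.realize x = F x}
  zero_mem' := ⟨zeroTerm, fun _ => rfl⟩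
  add_mem' := by
    rintro _ _ ⟨s, hs⟩ ⟨t, ht⟩
    exact ⟨binTerm .add s t, fun x => congrArg₂ _ (hs x) (ht x)⟩
  neg_mem' := by
    rintro _ ⟨s, hs⟩
    exact ⟨negTerm s, fun x => congrArg _ (hs x)⟩

theorem supClosed_termFunctions : SupClosed (termFunctions α : Set ((α → ℝ) → ℝ)) := by
  rintro _ ⟨s, hs⟩ _ ⟨t, ht⟩
  exact ⟨binTerm .join s t, fun x => congrArg₂ _ (hs x) (ht x)⟩

theorem infClosed_termFunctions : InfClosed (termFunctions α : Set ((α → ℝ) → ℝ)) := by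
  rintro _ ⟨s, hs⟩ _ ⟨t, ht⟩
  exact ⟨binTerm .meet s t, fun x => congrArg₂ _ (hs x) (ht x)⟩

theorem nsmul_evalForm_mem_termFunctions [Fintype α] {K : ℕ} {l : α → ℚ} {p : α → ℤ}
    (hp : ∀ a, (p a : ℚ) = K * l a) :
    (fun x : α → ℝ => K • evalForm x l) ∈ termFunctions α := by
  have : (fun x : α → ℝ => K • evalForm x l) = ∑ a, p a • fun x => x a := by
    ext x
    simp only [Fintype.linearCombination_apply, Finset.sum_apply, Pi.smul_apply, Finset.smul_sum]
    refine Finset.sum_congr rfl fun a _ => ?_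
    rw [← Int.cast_smul_eq_zsmul ℚ, hp, mul_smul, Nat.cast_smul_eq_nsmul]
  rw [this]
  have hvar : ∀ a, (fun x : α → ℝ => x a) ∈ termFunctions α := fun a =>
    ⟨Term.var a, fun _ => rfl⟩
  exact sum_mem fun a _ => zsmul_mem (hvar a) _

theorem exists_form_le_and_le {Γ : Set (Fin φ.m → Fin φ.n → ℚ)} (hΓ : Γ.Finite)
    (h : ∀ x : Fin φ.n → ℝ, ∃ γ ∈ Γ, Solves φ x fun j => evalForm x (γ j))
    {f : (Fin φ.n → ℝ) → Fin φ.m → ℝ} (hf : ∀ x z, Solves φ x z → z = f x) (j : Fin φ.m)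
    (x y : Fin φ.n → ℝ) : ∃ γ ∈ Γ, evalForm x (γ j) ≤ f x j ∧ f y j ≤ evalForm y (γ j) := by
  let c (t : ℝ) : Fin φ.n → ℝ := fun i => x i + t * (y i - x i)
  have hc : ∀ t (l : Fin φ.n → ℚ),
      evalForm (c t) l = evalForm x l + t * (evalForm y l - evalForm x l) := fun t l => by
    simp only [Fintype.linearCombination_apply, c, Rat.smul_def, mul_add, Finset.sum_add_distrib,
      ← Finset.sum_sub_distrib, Finset.mul_sum]
    congr 1
    exact Finset.sum_congr rfl fun i _ => by ring
  have hccont : Continuous c := by fun_prop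
  have : Finite Γ := hΓ
  have hclosed : ∀ γ : Γ, IsClosed {t | Solves φ (c t) fun j => evalForm (c t) (γ.1 j)} :=
    fun γ => by
      simp only [Solves, Set.ofPred_forall]
      have hv : Continuous fun t => Sum.elim (c t) fun j => evalForm (c t) (γ.1 j) := by
        refine continuous_pi fun a => ?_
        rcases a with i | j
        · exact (continuous_apply i).comp hccont
        · simp only [Sum.elim_inr, hc]
          fun_prop
      exact isClosed_iInter fun i =>
        isClosed_eq ((continuous_realize _).comp hv) ((continuous_realize _).comp hv)
  obtain ⟨γ, h0, h1⟩ := exists_affine_piece hclosed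
    (fun t => let ⟨γ, hγ, hs⟩ := h (c t); ⟨⟨γ, hγ⟩, hs⟩)
    (fun γ => evalForm x (γ.1 j)) (fun γ => evalForm y (γ.1 j) - evalForm x (γ.1 j))
    (fun t => f (c t) j) (fun γ t ht => by rw [← hf _ _ ht, ← hc])
  have c0 : c 0 = x := by simp [c]
  have c1 : c 1 = y := by simp [c]
  rw [c0] at h0
  rw [c1, add_sub_cancel] at h1
  exact ⟨γ, γ.2, h0, h1⟩

theorem exists_terms_solving {A : Type} [Lattice A] [AddCommGroup A] [AddLeftMono A]
    [Nontrivial A] (hA : φ.Satisfies A) :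
    ∃ (K : ℕ) (t : Fin φ.m → LGrpLang.Term (Fin φ.n)), 0 < K ∧
      ∀ (x : Fin φ.n → ℝ) (z : Fin φ.m → ℝ), Solves φ x z ↔ ∀ j, K • z j = (t j).realize x := by
  obtain ⟨D, _, _, _, _, _, _, hD⟩ := exists_rat_space_solvable hA
  obtain ⟨Γ, hΓ, hcov⟩ := exists_forms_solving hD fun x z z' => Solves.unique hA
  have hR : ∀ x : Fin φ.n → ℝ, ∃ γ ∈ Γ, Solves φ x fun j => evalForm x (γ j) :=
    forms_solving_transfer hΓ hcov
  choose g hg hsol using hR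
  have hf : ∀ x z, Solves φ x z → z = fun j => evalForm x (g x j) := fun x z hz =>
    Solves.unique hA hz (hsol x)
  have : Finite Γ := hΓ
  obtain ⟨K, hK, p, hp⟩ :=
    exists_common_denom fun a : Γ × Fin φ.m × Fin φ.n => a.1.1 a.2.1 a.2.2
  have hmem : ∀ j, (fun x => K • evalForm x (g x j)) ∈ termFunctions (Fin φ.n) := fun j => by
    refine mem_of_forall_exists_le_and_le supClosed_termFunctions infClosed_termFunctions
      (hΓ.image fun γ x => K • evalForm x (γ j)) ?_ fun x y => ?_
    · rintro _ ⟨γ, hγ, rfl⟩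
      exact nsmul_evalForm_mem_termFunctions fun a => hp (⟨γ, hγ⟩, j, a)
    · obtain ⟨γ, hγ, hx, hy⟩ := exists_form_le_and_le hΓ (fun x => ⟨g x, hg x, hsol x⟩) hf j x y
      exact ⟨_, ⟨γ, hγ, rfl⟩, nsmul_le_nsmul_right hx K, nsmul_le_nsmul_right hy K⟩
  choose t ht using hmem
  refine ⟨K, t, hK, fun x z => ⟨fun hz j => ?_, fun hz => ?_⟩⟩
  · rw [ht, hf x z hz]
  · have : z = fun j => evalForm x (g x j) := funext fun j =>
      nsmul_right_injective hK.ne' ((hz j).trans (ht j x))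
    rw [this]
    exact hsol x

end Real

section Transport

variable {φ : EFDSystem LGrpLang}

theorem eq_of_forall_map_eq {G : Type} [Lattice G] [AddCommGroup G] [AddLeftMono G] {a b : G}
    (h : ∀ (D : Type) [AddCommGroup D] [LinearOrder D] [IsOrderedAddMonoid D] [Module ℚ D]
      [IsStrictOrderedModule ℚ D] (f : G →+ D), (∀ x y, f (x ⊔ y) = f x ⊔ f y) → f a = f b) :
    a = b := by
  by_contra hab
  obtain ⟨D, _, _, _, _, _, f, hsup, hf⟩ := exists_map_ne_zero (sub_ne_zero.2 hab)
  exact hf (by rw [map_sub, h D f hsup, sub_self])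

theorem nsmul_injective {G : Type} [Lattice G] [AddCommGroup G] [AddLeftMono G] {k : ℕ}
    (hk : 0 < k) : Function.Injective fun a : G => k • a := fun a b hab =>
  eq_of_forall_map_eq fun D _ _ _ _ _ f _ => nsmul_right_injective hk.ne' <| by
    simpa using congrArg f hab

theorem solves_iff_of_real {K : ℕ} {t : Fin φ.m → LGrpLang.Term (Fin φ.n)}
    (h : ∀ (x : Fin φ.n → ℝ) (z : Fin φ.m → ℝ), Solves φ x z ↔ ∀ j, K • z j = (t j).realize x)
    {D : Type} [AddCommGroup D] [LinearOrder D] [IsOrderedAddMonoid D] [Module ℚ D]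
    [IsStrictOrderedModule ℚ D] (x : Fin φ.n → D) (z : Fin φ.m → D) :
    Solves φ x z ↔ ∀ j, K • z j = (t j).realize x := by
  choose s hs using fun j : Fin φ.m =>
    exists_realize_eq_nsmul K (Term.var (Sum.inr j) : LGrpLang.Term (Fin φ.n ⊕ Fin φ.m))
  obtain ⟨e, he⟩ := exists_same_equations ℝ (Sum.elim φ.lhs s)
    (Sum.elim φ.rhs fun j => (t j).relabel Sum.inl) (Sum.elim x z)
  simp only [Sum.forall, Sum.elim_inl, Sum.elim_inr, hs, Term.realize_relabel, Term.realize_var,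
    Sum.elim_comp_inl] at he
  have := h (e ∘ Sum.inl) (e ∘ Sum.inr)
  simp only [Solves, Sum.elim_comp_inl_inr, Function.comp_apply] at this ⊢
  exact (forall_congr' he.1).trans (this.trans (forall_congr' he.2).symm)

theorem solves_iff {K : ℕ} {t : Fin φ.m → LGrpLang.Term (Fin φ.n)}
    (h : ∀ (x : Fin φ.n → ℝ) (z : Fin φ.m → ℝ), Solves φ x z ↔ ∀ j, K • z j = (t j).realize x)
    {G : Type} [Lattice G] [AddCommGroup G] [AddLeftMono G] (x : Fin φ.n → G) (z : Fin φ.m → G) :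
    Solves φ x z ↔ ∀ j, K • z j = (t j).realize x := by
  refine ⟨fun hz j => eq_of_forall_map_eq fun D _ _ _ _ _ f hf => ?_,
    fun hz i => eq_of_forall_map_eq fun D _ _ _ _ _ f hf => ?_⟩
  · rw [map_nsmul, ← realize_comp_of_map_sup _ _ f hf]
    exact (solves_iff_of_real h _ _).1 (hz.map f hf) j
  · rw [← realize_comp_of_map_sup _ _ f hf, ← realize_comp_of_map_sup _ _ f hf, Sum.comp_elim]
    refine (solves_iff_of_real h (f ∘ x) (f ∘ z)).2 (fun j => ?_) i
    rw [realize_comp_of_map_sup _ _ f hf, ← hz j, map_nsmul, Function.comp_apply]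

end Transport

end LGrp

/-- Every EFD-sentence with a nontrivial abelian ℓ-group model is equivalent, over all
abelian ℓ-groups, to a conjunction of sentences `∀ x̄ ∃! z, k_j z = t_j(x̄)` for suitable
positive integers `k_j` and ℓ-group terms `t_j`. -/
theorem efd_equiv_conj_delta_kt (φ : EFDSystem LGrpLang)
    (A : Type) [Lattice A] [AddCommGroup A] [CovariantClass A A (· + ·) (· ≤ ·)]
    [Nontrivial A] (hA : φ.Satisfies A) :
    ∃ (k : Fin φ.m → ℕ) (t : Fin φ.m → LGrpLang.Term (Fin φ.n)),
      (∀ j, 0 < k j) ∧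
      ∀ (G : Type) [Lattice G] [AddCommGroup G] [CovariantClass G G (· + ·) (· ≤ ·)],
        φ.Satisfies G ↔
          ∀ (j : Fin φ.m) (x : Fin φ.n → G), ∃! z : G, (k j) • z = Term.realize x (t j) := by
  obtain ⟨K, t, hK, h⟩ := LGrp.exists_terms_solving hA
  refine ⟨fun _ => K, t, fun _ => hK, fun G _ _ _ => ⟨fun hG j x => ?_, fun hG x => ?_⟩⟩
  · obtain ⟨z, hz, -⟩ := hG x
    have hz := (LGrp.solves_iff h x z).1 hz j
    exact ⟨z j, hz, fun w hw => LGrp.nsmul_injective hK (hw.trans hz.symm)⟩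
  · choose z hz huniq using fun j => hG j x
    exact ⟨z, (LGrp.solves_iff h x z).2 hz, fun w hw =>
      funext fun j => huniq j (w j) ((LGrp.solves_iff h x w).1 hw j)⟩
end
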